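/- arXiv:0711.1937 — 2 statements merged into one kernel-verified Lean document; each statement's English description precedes it below -/
import Mathlib

section
/- Let s ≥ 2 and k > s+1. Then Γ_{s+1}^{[s,s]×k} = 21·(2^{k+s−1} + 2^{3s−1} − 5·2^{2s−1}). -/
open Matrix

/-- The `a × k` Hankel (persymmetric) matrix over `F_2` whose `(i,j)` entry is `α (i+j)`. -/
def hankel (a k : ℕ) (α : Fin (a + k - 1) → ZMod 2) :
    Matrix (Fin a) (Fin k) (ZMod 2) :=
  Matrix.of fun i j => α ⟨(i : ℕ) + (j : ℕ), by have := i.isLt; have := j.isLt; omega⟩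

/-- `Γ_i^{[a,b]×k}` : the number of pairs `(α, β)` such that the `(a+b) × k` matrix obtained
by stacking the `a × k` Hankel matrix of `α` on top of the `b × k` Hankel matrix of `β`
has rank `i` over `F_2`. -/
noncomputable def Gamma (a b k i : ℕ) : ℕ :=
  Nat.card {p : (Fin (a + k - 1) → ZMod 2) × (Fin (b + k - 1) → ZMod 2) //
    (Matrix.fromRows (hankel a k p.1) (hankel b k p.2)).rank = i}

section

open Polynomial

/-- The submodule of polynomials of degree `< k` whose coefficient vector is killed by `B` has
dimension complementary to the rank of `B`. -/
theorem finrank_add_rank_of_mem_iff {K ι : Type*} [Field K] [Fintype ι] {k : ℕ}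
    (B : Matrix ι (Fin k) K) (S : Submodule K K[X])
    (hS : ∀ p, p ∈ S ↔ p ∈ degreeLT K k ∧ B *ᵥ (fun i : Fin k => p.coeff i) = 0) :
    Module.finrank K S + B.rank = k := by
  have hmap : S = (LinearMap.ker (B.mulVecLin ∘ₗ (degreeLTEquiv K k).toLinearMap)).map
      (degreeLT K k).subtype := by
    ext p
    rw [hS, Submodule.mem_map]
    constructor
    · rintro ⟨hp, h⟩
      exact ⟨⟨p, hp⟩, h, rfl⟩
    · rintro ⟨⟨q, hq⟩, h, rfl⟩
      exact ⟨hq, h⟩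
  have hrange : LinearMap.range (B.mulVecLin ∘ₗ (degreeLTEquiv K k).toLinearMap) =
      LinearMap.range B.mulVecLin := by
    rw [LinearMap.range_comp, LinearEquiv.range, Submodule.map_top]
  have hdim := LinearMap.finrank_range_add_finrank_ker
    (B.mulVecLin ∘ₗ (degreeLTEquiv K k).toLinearMap)
  rw [hrange, (degreeLTEquiv K k).finrank_eq, Module.finrank_fin_fun] at hdim
  rw [hmap, Submodule.finrank_map_subtype_eq, Matrix.rank]
  omega

theorem Matrix.finrank_ker_vecMul_add_rank {K : Type*} [Field K] {m n : ℕ}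
    (B : Matrix (Fin m) (Fin n) K) :
    Module.finrank K (LinearMap.ker B.vecMulLinear) + B.rank = m := by
  have h := LinearMap.finrank_range_add_finrank_ker B.vecMulLinear
  rw [Module.finrank_fin_fun] at h
  have h2 : B.rank = Module.finrank K (LinearMap.range B.vecMulLinear) := by
    rw [← Matrix.rank_transpose, Matrix.rank, Matrix.mulVecLin_transpose]
  omega

/-- The linear functional `X ^ i ↦ α i` (for `i < N`) attached to a finite sequence. -/
noncomputable def moment {K : Type*} [Field K] {N : ℕ} (α : Fin N → K) : K[X] →ₗ[K] K :=
  ∑ i : Fin N, α i • lcoeff K i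

theorem moment_apply {K : Type*} [Field K] {N : ℕ} (α : Fin N → K) (p : K[X]) :
    moment α p = ∑ i : Fin N, α i * p.coeff i := by
  simp [moment]

theorem moment_init {K : Type*} [Field K] {N : ℕ} (α : Fin (N + 1) → K) {p : K[X]}
    (hp : p ∈ degreeLT K N) : moment (Fin.init α : Fin N → K) p = moment α p := by
  have : p.coeff N = 0 := coeff_eq_zero_of_degree_lt (mem_degreeLT.1 hp)
  simp [moment_apply, Fin.sum_univ_castSucc, Fin.init, this]

theorem moment_tail {K : Type*} [Field K] {N : ℕ} (α : Fin (N + 1) → K) (p : K[X]) :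
    moment (Fin.tail α : Fin N → K) p = moment α (X * p) := by
  simp [moment_apply, Fin.sum_univ_succ, Fin.tail]

theorem moment_X_pow_mul {K : Type*} [Field K] {N m j : ℕ} (α : Fin N → K) {p : K[X]}
    (hp : p ∈ degreeLT K m) (hj : j + m ≤ N) :
    moment α (X ^ j * p) = ∑ i : Fin m, p.coeff i * α ⟨i + j, by omega⟩ := by
  have hcoeff : ∀ i, m ≤ i → p.coeff i = 0 := fun i hi =>
    coeff_eq_zero_of_degree_lt ((mem_degreeLT.1 hp).trans_le (by exact_mod_cast hi))
  let e : Fin m ↪ Fin N := ⟨fun i => ⟨i + j, by omega⟩, fun a b h => by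
    simpa [Fin.ext_iff] using h⟩
  rw [moment_apply]
  symm
  rw [← Finset.sum_subset (Finset.subset_univ (Finset.univ.map e)), Finset.sum_map]
  · refine Finset.sum_congr rfl fun i _ => ?_
    change _ = α ⟨i + j, _⟩ * (X ^ j * p).coeff (i + j)
    rw [coeff_X_pow_mul, mul_comm]
  · intro i _ hi
    rw [coeff_X_pow_mul']
    split_ifs with h
    · rw [hcoeff, mul_zero]
      by_contra hlt
      exact hi (Finset.mem_map.2 ⟨⟨i - j, by omega⟩, Finset.mem_univ _, by
        ext; exact Nat.sub_add_cancel h⟩)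
    · simp

/-- The polynomials of degree `< m` which annihilate all windows of length `m` of `α`, i.e. the
linear recurrences of length `m` satisfied by `α`. -/
def recurrences {K : Type*} [Field K] {N : ℕ} (α : Fin N → K) (m : ℕ) : Submodule K K[X] where
  carrier := {p | p ∈ degreeLT K m ∧ ∀ j, j + m ≤ N → moment α (X ^ j * p) = 0}
  add_mem' := fun ⟨ha, ha'⟩ ⟨hb, hb'⟩ => ⟨add_mem ha hb, fun j hj => by
    rw [mul_add, map_add, ha' j hj, hb' j hj, add_zero]⟩
  zero_mem' := ⟨zero_mem _, fun j _ => by simp⟩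
  smul_mem' := fun c p ⟨hp, hp'⟩ => ⟨Submodule.smul_mem _ c hp, fun j hj => by
    rw [mul_smul_comm, map_smul, hp' j hj, smul_zero]⟩

theorem mem_recurrences {K : Type*} [Field K] {N : ℕ} {α : Fin N → K} {m : ℕ} {p : K[X]} :
    p ∈ recurrences α m ↔
      p ∈ degreeLT K m ∧ ∀ j, j + m ≤ N → moment α (X ^ j * p) = 0 := Iff.rfl

theorem X_mul_mem_degreeLT_succ {K : Type*} [Field K] {m : ℕ} {p : K[X]} :
    X * p ∈ degreeLT K (m + 1) ↔ p ∈ degreeLT K m := by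
  simp only [mem_degreeLT, degree_lt_iff_coeff_zero]
  constructor
  · intro h i hi
    simpa using h (i + 1) (by omega)
  · rintro h (_ | i) hi
    · simp
    · simpa using h i (by omega)

theorem recurrences_le_succ {K : Type*} [Field K] {N : ℕ} (α : Fin N → K) (m : ℕ) :
    recurrences α m ≤ recurrences α (m + 1) := fun _ hp =>
  ⟨degreeLT_mono (Nat.le_succ m) hp.1, fun j hj => hp.2 j (by omega)⟩

theorem X_mul_mem_recurrences_succ {K : Type*} [Field K] {N : ℕ} {α : Fin N → K} {m : ℕ} {p : K[X]}
    (hp : p ∈ recurrences α m) : X * p ∈ recurrences α (m + 1) := by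
  refine ⟨X_mul_mem_degreeLT_succ.2 hp.1, fun j hj => ?_⟩
  rw [← mul_assoc, ← pow_succ]
  exact hp.2 (j + 1) (by omega)

theorem mem_recurrences_of_X_mul_mem {K : Type*} [Field K] {N : ℕ} {α : Fin N → K}
    {m : ℕ} {p : K[X]}
    (hm : m + 1 ≤ N) (hp : p ∈ recurrences α (m + 1)) (hX : X * p ∈ recurrences α (m + 1)) :
    p ∈ recurrences α m := by
  refine ⟨X_mul_mem_degreeLT_succ.1 hX.1, fun j hj => ?_⟩
  rcases j with _ | j
  · exact hp.2 0 (by omega)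
  · rw [pow_succ, mul_assoc]
    exact hX.2 j (by omega)

/-- The common linear recurrences of length `m` of two sequences. -/
noncomputable def commonRecurrences {K : Type*} [Field K] {N : ℕ} (α β : Fin N → K) (m : ℕ) :
    Submodule K K[X] :=
  recurrences α m ⊓ recurrences β m

instance {K : Type*} [Field K] (m : ℕ) : Module.Finite K (degreeLT K m) :=
  Module.Finite.equiv (degreeLTEquiv K m).symm

instance {K : Type*} [Field K] {N : ℕ} (α β : Fin N → K) (m : ℕ) :
    Module.Finite K (commonRecurrences α β m) :=
  Submodule.finiteDimensional_of_le (S₂ := degreeLT K m) fun _ hp => hp.1.1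

theorem finrank_commonRecurrences_convex {K : Type*} [Field K] {N : ℕ} (α β : Fin N → K) {m : ℕ}
    (hm : m + 1 ≤ N) :
    2 * Module.finrank K (commonRecurrences α β (m + 1)) ≤
      Module.finrank K (commonRecurrences α β (m + 2)) +
        Module.finrank K (commonRecurrences α β m) := by
  set S := commonRecurrences α β (m + 1)
  have hinj : Function.Injective (LinearMap.mulLeft K (X : K[X])) := fun a b h =>
    mul_left_cancel₀ X_ne_zero h
  have hsup : S ⊔ S.map (LinearMap.mulLeft K X) ≤ commonRecurrences α β (m + 2) := by
    refine sup_le (inf_le_inf (recurrences_le_succ _ _) (recurrences_le_succ _ _)) ?_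
    rintro _ ⟨p, hp, rfl⟩
    exact ⟨X_mul_mem_recurrences_succ hp.1, X_mul_mem_recurrences_succ hp.2⟩
  have hinf : S ⊓ S.map (LinearMap.mulLeft K X) ≤
      (commonRecurrences α β m).map (LinearMap.mulLeft K X) := by
    rintro _ ⟨hX, p, hp, rfl⟩
    exact ⟨p, ⟨mem_recurrences_of_X_mul_mem hm hp.1 hX.1,
      mem_recurrences_of_X_mul_mem hm hp.2 hX.2⟩, rfl⟩
  have h1 := Submodule.finrank_mono hsup
  have h2 := Submodule.finrank_mono hinf
  have h3 := Submodule.finrank_sup_add_finrank_inf_eq S (S.map (LinearMap.mulLeft K X))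
  rw [← (Submodule.equivMapOfInjective _ hinj _).finrank_eq] at h2 h3
  omega

end

theorem Int.slope_le_slope_of_convex {i : ℕ → ℤ} {N : ℕ}
    (hi : ∀ m, m + 1 ≤ N → 2 * i (m + 1) ≤ i (m + 2) + i m) {a b : ℕ} (hab : a ≤ b)
    (hb : b ≤ N) : i (a + 1) - i a ≤ i (b + 1) - i b := by
  induction b, hab using Nat.le_induction with
  | base => exact le_rfl
  | succ b _ ih =>
    have h1 := hi b hb
    have h2 := ih (by omega)
    change _ ≤ i (b + 2) - i (b + 1)
    linarith

theorem Int.add_mul_le_of_convex {i : ℕ → ℤ} {N : ℕ}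
    (hi : ∀ m, m + 1 ≤ N → 2 * i (m + 1) ≤ i (m + 2) + i m) {a b : ℕ} {t : ℤ} (hab : a ≤ b)
    (hb : b ≤ N + 1) (ht : t ≤ i (a + 1) - i a) : i a + t * (b - a) ≤ i b := by
  induction b, hab using Nat.le_induction with
  | base => simp
  | succ b hab ih =>
    have h1 := ih (by omega)
    have h2 := Int.slope_le_slope_of_convex hi hab (by omega)
    push_cast
    linarith

theorem Int.le_add_mul_of_convex {i : ℕ → ℤ} {N : ℕ}
    (hi : ∀ m, m + 1 ≤ N → 2 * i (m + 1) ≤ i (m + 2) + i m) {a b : ℕ} {t : ℤ} (hab : a ≤ b)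
    (hb : b ≤ N) (ht : i (b + 1) - i b ≤ t) : i (b + 1) ≤ i a + t * (b + 1 - a) := by
  have key : ∀ c, a ≤ c → c ≤ b + 1 → i c ≤ i a + t * (c - a) := by
    intro c hac
    induction c, hac using Nat.le_induction with
    | base => simp
    | succ c hac ih =>
      intro hc
      have h1 := ih (by omega)
      have h2 := Int.slope_le_slope_of_convex hi (show c ≤ b by omega) hb
      push_cast
      linarith
  simpa using key (b + 1) (by omega) le_rfl

theorem Int.eq_iff_of_convex_of_pos {i : ℕ → ℤ} {s k N : ℕ}
    (hi : ∀ m, m + 1 ≤ N → 2 * i (m + 1) ≤ i (m + 2) + i m) (h0 : i 0 = 0) (hnn : ∀ m, 0 ≤ i m)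
    (hs : 2 ≤ s) (hk : s + 2 ≤ k) (hN : s + k = N + 1) (hiN : i N = N - 2)
    (hpos : 0 < i (s + 2)) : i k = k - s - 1 ↔ i (s + 1) = 0 := by
  have hslope : 1 ≤ i (s + 1 + 1) - i (s + 1) := by
    by_contra! h
    have := Int.le_add_mul_of_convex hi (Nat.zero_le (s + 1)) (by omega)
      (Int.lt_add_one_iff.1 h : _ ≤ (0 : ℤ))
    simp only [h0, zero_mul, add_zero] at this
    exact this.not_gt hpos
  have hge := Int.add_mul_le_of_convex hi (show s + 1 ≤ k by omega) (by omega) hslope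
  push_cast at hge
  refine ⟨fun h => ?_, fun h => ?_⟩
  · have := hnn (s + 1)
    omega
  · by_contra hne
    obtain ⟨l, rfl⟩ : ∃ l, k = l + 1 := ⟨k - 1, by omega⟩
    have hslope2 : 2 ≤ i (l + 1) - i l := by
      by_contra! h'
      have := Int.le_add_mul_of_convex hi (show s + 1 ≤ l by omega) (by omega)
        (show _ ≤ (1 : ℤ) by omega)
      push_cast at this hne hge
      omega
    have h3 := Int.slope_le_slope_of_convex hi (Nat.le_succ l) (by omega)
    have h4 := Int.add_mul_le_of_convex hi (show l + 1 ≤ N by omega) (by omega)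
      (hslope2.trans h3)
    push_cast at *
    omega

theorem Int.dichotomy_of_convex {i : ℕ → ℤ} {s k N : ℕ}
    (hi : ∀ m, m + 1 ≤ N → 2 * i (m + 1) ≤ i (m + 2) + i m)
    (hs : 2 ≤ s) (hk : s + 2 ≤ k) (hN : s + k = N + 1) (hiN : i N = N - 2)
    (hzero : i (s + 2) = 0) (hlow : (N : ℤ) - 5 ≤ i (N - 1)) :
    i k = k - s - 1 ∧ i (N - 1) = N - 4 ∨ i k ≠ k - s - 1 ∧ i (N - 1) = N - 5 := by
  obtain ⟨n, rfl⟩ : ∃ n, N = n + 1 := ⟨N - 1, by omega⟩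
  simp only [Nat.add_sub_cancel] at *
  have hupp : i n ≤ n + 1 - 4 := by
    by_contra! h
    have := Int.le_add_mul_of_convex hi (show s + 2 ≤ n by omega) (by omega)
      (show i (n + 1) - i n ≤ 1 by push_cast at *; omega)
    push_cast at *
    omega
  by_cases hk' : i k = k - s - 1
  · refine Or.inl ⟨hk', le_antisymm (by push_cast; omega) ?_⟩
    obtain ⟨l, rfl⟩ : ∃ l, k = l + 1 := ⟨k - 1, by omega⟩
    have hlt : s + 2 ≤ l := by
      by_contra! h
      obtain rfl : l = s + 1 := by omega
      rw [show s + 1 + 1 = s + 2 from rfl, hzero] at hk'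
      push_cast at hk'
      omega
    have hslope : 2 ≤ i (l + 1) - i l := by
      by_contra! h
      have := Int.le_add_mul_of_convex hi hlt (by omega) (show i (l + 1) - i l ≤ 1 by omega)
      push_cast at *
      omega
    have h3 := Int.slope_le_slope_of_convex hi (Nat.le_succ l) (by omega)
    have h4 := Int.add_mul_le_of_convex hi (show l + 1 ≤ n by omega) (by omega)
      (hslope.trans h3)
    push_cast at *
    omega
  · refine Or.inr ⟨hk', ?_⟩
    by_contra hne
    have hin : i n = n - 3 := by push_cast at *; omega
    have h1 := Int.le_add_mul_of_convex hi (show k ≤ n by omega) (by omega)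
      (show i (n + 1) - i n ≤ 2 by push_cast at *; omega)
    have h2 : i (k + 1) - i k ≤ 1 := by
      by_contra! h
      have := Int.add_mul_le_of_convex hi (show k ≤ n + 1 by omega) (by omega)
        (show (2 : ℤ) ≤ _ from h)
      push_cast at *
      omega
    obtain rfl | hlt := eq_or_lt_of_le hk
    · push_cast at *
      omega
    · obtain ⟨l, rfl⟩ : ∃ l, k = l + 1 := ⟨k - 1, by omega⟩
      have h3 := Int.slope_le_slope_of_convex hi (Nat.le_succ l) (by omega)
      have h4 := Int.le_add_mul_of_convex hi (show s + 2 ≤ l by omega) (by omega) (h3.trans h2)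
      push_cast at *
      omega

theorem Int.eq_zero_or_eq_add_one_of_convex {i : ℕ → ℤ} {m N : ℕ}
    (hi : ∀ m, m + 1 ≤ N → 2 * i (m + 1) ≤ i (m + 2) + i m) (h0 : i 0 = 0) (hnn : ∀ m, 0 ≤ i m)
    (hm : m + 1 ≤ N) (hmN : 2 * m ≤ N + 1) (hiN : i N = N - 2) :
    i m = 0 ∧ i (m + 1) = 0 ∨ i (m + 1) = i m + 1 := by
  by_cases hpos : i (m + 1) = 0
  · refine Or.inl ⟨(hnn m).antisymm' ?_, hpos⟩
    have h1 := Int.slope_le_slope_of_convex hi (Nat.zero_le m) (by omega)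
    have h2 := hnn (0 + 1)
    omega
  · have h1 : 1 ≤ i (m + 1) - i m := by
      by_contra! h
      have := Int.le_add_mul_of_convex hi (Nat.zero_le m) (by omega) (show _ ≤ (0 : ℤ) by omega)
      have := hnn (m + 1)
      simp only [h0, zero_mul, add_zero] at *
      omega
    have h2 : i (m + 1) - i m ≤ 1 := by
      by_contra! h
      have := Int.add_mul_le_of_convex hi (show m ≤ N by omega) (by omega)
        (show (2 : ℤ) ≤ _ from h)
      have := hnn m
      omega
    omega

section

open Polynomial

theorem commonRecurrences_zero {K : Type*} [Field K] {N : ℕ} (α β : Fin N → K) :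
    commonRecurrences α β 0 = ⊥ := by
  refine (Submodule.eq_bot_iff _).2 fun p hp => ?_
  simpa [mem_degreeLT] using hp.1.1

theorem mem_recurrences_self {K : Type*} [Field K] {N : ℕ} {α : Fin N → K} {p : K[X]} :
    p ∈ recurrences α N ↔ p ∈ degreeLT K N ∧ moment α p = 0 := by
  refine and_congr_right fun _ => ⟨fun h => by simpa using h 0 (by omega), fun h j hj => ?_⟩
  obtain rfl : j = 0 := by omega
  simpa using h

theorem mem_recurrences_pred {K : Type*} [Field K] {n : ℕ} {α : Fin (n + 1) → K} {p : K[X]} :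
    p ∈ recurrences α n ↔ p ∈ degreeLT K n ∧
      moment (Fin.init α : Fin n → K) p = 0 ∧ moment (Fin.tail α : Fin n → K) p = 0 := by
  refine and_congr_right fun hp => ?_
  rw [moment_init _ hp, moment_tail]
  refine ⟨fun h => ⟨by simpa using h 0 (by omega), by simpa using h 1 (by omega)⟩,
    fun h j hj => ?_⟩
  obtain rfl | rfl : j = 0 ∨ j = 1 := by omega
  · simpa using h.1
  · simpa using h.2

theorem mem_recurrences_iff_hankel {s k : ℕ} (hs : 0 < s) {γ : Fin (s + k - 1) → ZMod 2}
    {p : (ZMod 2)[X]} : p ∈ recurrences γ k ↔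
      p ∈ degreeLT (ZMod 2) k ∧ hankel s k γ *ᵥ (fun i : Fin k => p.coeff i) = 0 := by
  refine and_congr_right fun hp => ?_
  have key : ∀ j : Fin s, (hankel s k γ *ᵥ fun i : Fin k => p.coeff i) j =
      moment γ (X ^ (j : ℕ) * p) := by
    intro j
    rw [moment_X_pow_mul γ hp (by omega)]
    simp only [Matrix.mulVec, dotProduct, hankel, Matrix.of_apply]
    exact Finset.sum_congr rfl fun i _ => by rw [mul_comm]; congr 3; exact add_comm _ _
  rw [funext_iff]
  exact ⟨fun h j => (key j).trans (h j (by omega)),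
    fun h j hj => (key ⟨j, by omega⟩).symm.trans (h ⟨j, by omega⟩)⟩

theorem finrank_commonRecurrences_add_rank_fromRows {s k : ℕ} (hs : 0 < s)
    (α β : Fin (s + k - 1) → ZMod 2) :
    Module.finrank (ZMod 2) (commonRecurrences α β k) +
      (Matrix.fromRows (hankel s k α) (hankel s k β)).rank = k := by
  refine finrank_add_rank_of_mem_iff _ _ fun p => ?_
  rw [commonRecurrences, Submodule.mem_inf, mem_recurrences_iff_hankel hs,
    mem_recurrences_iff_hankel hs, Matrix.fromRows_mulVec]
  simp only [funext_iff, Sum.forall, Sum.elim_inl, Sum.elim_inr, Pi.zero_apply]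
  tauto

theorem recurrences_zero {K : Type*} [Field K] {N : ℕ} (m : ℕ) :
    recurrences (0 : Fin N → K) m = degreeLT K m := by
  ext p
  simp [mem_recurrences, moment_apply]

theorem recurrences_le_degreeLT {K : Type*} [Field K] {N : ℕ} (α : Fin N → K) (m : ℕ) :
    recurrences α m ≤ degreeLT K m := fun _ hp => hp.1

/-- A pair of vectors which is linearly independent over the field with two elements. -/
def IsIndepPair {V : Type*} [Zero V] (p : V × V) : Prop :=
  p.1 ≠ 0 ∧ p.2 ≠ 0 ∧ p.1 ≠ p.2

theorem IsIndepPair.linearIndependent {V : Type*} [AddCommGroup V] [Module (ZMod 2) V]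
    {p : V × V} (hp : IsIndepPair p) : LinearIndependent (ZMod 2) ![p.1, p.2] := by
  rw [LinearIndependent.pair_iff]
  have h2 : ∀ x : ZMod 2, x = 0 ∨ x = 1 := by decide
  intro x y hxy
  rcases h2 x with rfl | rfl <;> rcases h2 y with rfl | rfl
  · simp
  · exact absurd (by simpa using hxy) hp.2.1
  · exact absurd (by simpa using hxy) hp.1
  · rw [one_smul, one_smul, add_eq_zero_iff_eq_neg, ZModModule.neg_eq_self] at hxy
    exact absurd hxy hp.2.2

theorem rank_fromRows_hankel_le_of_not_isIndepPair {s k : ℕ} (hs : 0 < s)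
    {α β : Fin (s + k - 1) → ZMod 2} (h : ¬ IsIndepPair (α, β)) :
    (Matrix.fromRows (hankel s k α) (hankel s k β)).rank ≤ s := by
  have key : ∃ γ : Fin (s + k - 1) → ZMod 2, recurrences γ k ≤ commonRecurrences α β k := by
    simp only [IsIndepPair, not_and_or, not_not] at h
    rcases h with rfl | rfl | rfl
    · exact ⟨β, le_inf (by simpa [recurrences_zero] using recurrences_le_degreeLT β k) le_rfl⟩
    · exact ⟨α, le_inf le_rfl (by simpa [recurrences_zero] using recurrences_le_degreeLT α k)⟩
    · exact ⟨α, le_inf le_rfl le_rfl⟩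
  obtain ⟨γ, hγ⟩ := key
  have h1 := Submodule.finrank_mono hγ
  have h2 := finrank_commonRecurrences_add_rank_fromRows hs α β
  have h3 := finrank_add_rank_of_mem_iff (hankel s k γ) (recurrences γ k)
    fun p => mem_recurrences_iff_hankel hs
  have h4 := (hankel s k γ).rank_le_height
  omega

theorem finrank_commonRecurrences_self {N : ℕ} {p : (Fin N → ZMod 2) × (Fin N → ZMod 2)}
    (hp : IsIndepPair p) :
    Module.finrank (ZMod 2) (commonRecurrences p.1 p.2 N) + 2 = N := by
  have hrank : (Matrix.of ![p.1, p.2]).rank = 2 := hp.linearIndependent.rank_matrix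
  have hdim := finrank_add_rank_of_mem_iff (Matrix.of ![p.1, p.2]) (commonRecurrences p.1 p.2 N)
    fun q => ?_
  · rwa [hrank] at hdim
  rw [commonRecurrences, Submodule.mem_inf, mem_recurrences_self, mem_recurrences_self,
    funext_iff, Fin.forall_fin_two]
  simp only [moment_apply, Matrix.mulVec, dotProduct, Matrix.of_apply, Matrix.cons_val_zero,
    Matrix.cons_val_one, Pi.zero_apply]
  tauto

end

/-- The sequences `α` and `β` satisfy the linear relation with coefficients `r` between their
truncations and shifts. -/
def ShiftRelation {n : ℕ} (p : (Fin (n + 1) → ZMod 2) × (Fin (n + 1) → ZMod 2))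
    (r : ZMod 2 × ZMod 2 × ZMod 2 × ZMod 2) : Prop :=
  r.1 • (Fin.init p.1 : Fin n → ZMod 2) + r.2.1 • (Fin.tail p.1 : Fin n → ZMod 2) +
    r.2.2.1 • (Fin.init p.2 : Fin n → ZMod 2) + r.2.2.2 • (Fin.tail p.2 : Fin n → ZMod 2) = 0

theorem exists_card_shiftRelation {n : ℕ} (p : (Fin (n + 1) → ZMod 2) × (Fin (n + 1) → ZMod 2)) :
    ∃ e, Module.finrank (ZMod 2) (commonRecurrences p.1 p.2 n) + 4 = n + e ∧
      Nat.card {r // ShiftRelation p r} = 2 ^ e := by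
  let B : Matrix (Fin 4) (Fin n) (ZMod 2) :=
    Matrix.of ![Fin.init p.1, Fin.tail p.1, Fin.init p.2, Fin.tail p.2]
  refine ⟨Module.finrank (ZMod 2) (LinearMap.ker B.vecMulLinear), ?_, ?_⟩
  · have h1 := B.finrank_ker_vecMul_add_rank
    have h2 : Module.finrank (ZMod 2) (commonRecurrences p.1 p.2 n) + B.rank = n := by
      refine finrank_add_rank_of_mem_iff _ _ fun q => ?_
      rw [commonRecurrences, Submodule.mem_inf, mem_recurrences_pred, mem_recurrences_pred,
        funext_iff]
      simp only [Fin.forall_fin_succ, moment_apply, Matrix.mulVec, dotProduct, Pi.zero_apply, B]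
      simp
      tauto
    omega
  · have hcard := Module.natCard_eq_pow_finrank (K := ZMod 2) (V := LinearMap.ker B.vecMulLinear)
    rw [Nat.card_zmod] at hcard
    rw [← hcard]
    refine Nat.card_congr
      { toFun := fun r => ⟨![r.1.1, r.1.2.1, r.1.2.2.1, r.1.2.2.2], ?_⟩
        invFun := fun r => ⟨(r.1 0, r.1 1, r.1 2, r.1 3), ?_⟩
        left_inv := fun r => rfl
        right_inv := fun r => by
          ext i
          fin_cases i <;> rfl }
    · have h := r.2
      rw [ShiftRelation] at h
      rw [LinearMap.mem_ker, ← h]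
      ext i
      simp [Matrix.vecMul, dotProduct, Fin.sum_univ_four, B]
    · obtain ⟨r, hr⟩ := r
      rw [LinearMap.mem_ker] at hr
      rw [ShiftRelation, ← hr]
      ext i
      simp [Matrix.vecMul, dotProduct, Fin.sum_univ_four, B]

theorem Fin.init_eq_zero_iff {n : ℕ} {α : Fin (n + 1) → ZMod 2} :
    (Fin.init α : Fin n → ZMod 2) = 0 ↔ α = 0 ∨ α = Pi.single (Fin.last n) 1 := by
  have h2 : ∀ x : ZMod 2, x = 0 ∨ x = 1 := by decide
  constructor
  · intro h
    refine (h2 (α (Fin.last n))).imp (fun h0 => ?_) fun h1 => ?_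
    all_goals
      ext i
      refine Fin.lastCases ?_ (fun j => ?_) i
      · simp [*]
      · have := congrFun h j
        simp_all [Fin.init]
  · rintro (rfl | rfl) <;> ext i <;> simp [Fin.init]

theorem Fin.tail_eq_zero_iff {n : ℕ} {α : Fin (n + 1) → ZMod 2} :
    (Fin.tail α : Fin n → ZMod 2) = 0 ↔ α = 0 ∨ α = Pi.single 0 1 := by
  have h2 : ∀ x : ZMod 2, x = 0 ∨ x = 1 := by decide
  constructor
  · intro h
    refine (h2 (α 0)).imp (fun h0 => ?_) fun h1 => ?_
    all_goals
      ext i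
      refine Fin.cases ?_ (fun j => ?_) i
      · simp [*]
      · have := congrFun h j
        simp_all [Fin.tail]
  · rintro (rfl | rfl) <;> ext i <;> simp [Fin.tail]

theorem Fin.init_eq_tail_iff {n : ℕ} {α : Fin (n + 1) → ZMod 2} :
    (Fin.init α : Fin n → ZMod 2) = Fin.tail α ↔ α = 0 ∨ α = 1 := by
  have h2 : ∀ x : ZMod 2, x = 0 ∨ x = 1 := by decide
  constructor
  · intro h
    have key : ∀ i, α i = α 0 := fun i => by
      induction i using Fin.induction with
      | zero => rfl
      | succ i ih => exact (congrFun h i).symm.trans ih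
    exact (h2 (α 0)).imp (fun h0 => funext fun i => (key i).trans h0)
      fun h1 => funext fun i => (key i).trans h1
  · rintro (rfl | rfl) <;> rfl

theorem Fin.init_snoc_tail {n : ℕ} {V : Type*} {α β : Fin (n + 1) → V}
    (h : (Fin.tail α : Fin n → V) = Fin.init β) :
    (Fin.tail (Fin.snoc α (β (Fin.last n)) : Fin (n + 2) → V) : Fin (n + 1) → V) = β := by
  ext i
  refine Fin.lastCases ?_ (fun j => ?_) i
  · simp [Fin.tail]
  · have := congrFun h j
    simp only [Fin.tail, Fin.init] at this ⊢
    rw [← this, ← Fin.castSucc_succ, Fin.snoc_castSucc]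

theorem Finset.intCast_card_erase {V : Type*} [DecidableEq V] (S : Finset V) (x : V) :
    ((S.erase x).card : ℤ) = S.card - if x ∈ S then 1 else 0 := by
  split_ifs with h
  · rw [Finset.card_erase_of_mem h, Nat.cast_sub (Finset.card_pos.2 ⟨x, h⟩), Nat.cast_one]
  · rw [Finset.erase_eq_of_notMem h, sub_zero]

open Classical in
/-- The number of the three nonzero sequences satisfying a first order relation that lie in `W`. -/
noncomputable def geometricCount {n : ℕ} (W : Submodule (ZMod 2) (Fin (n + 1) → ZMod 2)) : ℤ :=
  (if Pi.single 0 1 ∈ W then 1 else 0) + (if Pi.single (Fin.last n) 1 ∈ W then 1 else 0) +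
    if 1 ∈ W then 1 else 0

open Classical in
/-- The linearly independent pairs in `W`. -/
noncomputable def indepPairs {N : ℕ} (W : Submodule (ZMod 2) (Fin N → ZMod 2)) :
    Finset ((Fin N → ZMod 2) × (Fin N → ZMod 2)) :=
  Finset.univ.filter fun p => IsIndepPair p ∧ p.1 ∈ W ∧ p.2 ∈ W

theorem mem_indepPairs {N : ℕ} {W : Submodule (ZMod 2) (Fin N → ZMod 2)}
    {p : (Fin N → ZMod 2) × (Fin N → ZMod 2)} :
    p ∈ indepPairs W ↔ (p.1 ≠ 0 ∧ p.2 ≠ 0 ∧ p.1 ≠ p.2) ∧ p.1 ∈ W ∧ p.2 ∈ W := by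
  classical exact Finset.mem_filter.trans (and_iff_right (Finset.mem_univ _))

open Classical in
theorem card_filter_fst_eq_indepPairs {N : ℕ} (W : Submodule (ZMod 2) (Fin N → ZMod 2))
    {γ : Fin N → ZMod 2} (hγ : γ ≠ 0) :
    (((indepPairs W).filter fun p => p.1 = γ).card : ℤ) =
      (if γ ∈ W then 1 else 0) * (Nat.card W - 2) := by
  split_ifs with h
  · have hset : (indepPairs W).filter (fun p => p.1 = γ) =
        {γ} ×ˢ (((Finset.univ.filter (· ∈ W)).erase 0).erase γ) := by
      ext ⟨α, β⟩
      simp only [Finset.mem_filter, mem_indepPairs, Finset.mem_product, Finset.mem_singleton,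
        Finset.mem_erase, Finset.mem_univ, true_and]
      constructor
      · rintro ⟨h1, rfl⟩
        exact ⟨rfl, h1.1.2.2.symm, h1.1.2.1, h1.2.2⟩
      · rintro ⟨rfl, h1, h2, h3⟩
        exact ⟨⟨⟨hγ, h2, Ne.symm h1⟩, h, h3⟩, rfl⟩
    rw [hset, Finset.card_product, Finset.card_singleton, one_mul, Finset.intCast_card_erase,
      Finset.intCast_card_erase]
    rw [Nat.card_eq_fintype_card, Fintype.card_subtype]
    simp [h, hγ]
    ring
  · rw [zero_mul, Nat.cast_eq_zero, Finset.card_eq_zero, Finset.filter_eq_empty_iff]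
    rintro p hp rfl
    exact h (mem_indepPairs.1 hp).2.1

theorem card_indepPairs {N : ℕ} (W : Submodule (ZMod 2) (Fin N → ZMod 2)) :
    ((indepPairs W).card : ℤ) = (Nat.card W - 1) * (Nat.card W - 2) := by
  classical
  have hfib := Finset.card_eq_sum_card_fiberwise (f := Prod.fst) (s := indepPairs W)
    (t := (Finset.univ.filter (· ∈ W)).erase 0) fun p hp => by
      simpa using And.intro (mem_indepPairs.1 hp).2.1 (mem_indepPairs.1 hp).1.1
  rw [hfib, Nat.cast_sum, Finset.sum_congr rfl fun γ hγ =>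
    card_filter_fst_eq_indepPairs W (Finset.ne_of_mem_erase hγ)]
  rw [Finset.sum_congr rfl fun γ hγ => by
    rw [if_pos (Finset.mem_filter.1 (Finset.mem_of_mem_erase hγ)).2, one_mul]]
  rw [Finset.sum_const, nsmul_eq_mul, Finset.intCast_card_erase, Nat.card_eq_fintype_card,
    Fintype.card_subtype]
  simp

open Classical in
theorem card_indepPairs_filter_relation_fst {n : ℕ}
    (W : Submodule (ZMod 2) (Fin (n + 1) → ZMod 2)) {a b : ZMod 2} {γ : Fin (n + 1) → ZMod 2}
    (hγ : γ ≠ 0) (h : ∀ α : Fin (n + 1) → ZMod 2,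
      a • (Fin.init α : Fin n → ZMod 2) + b • (Fin.tail α : Fin n → ZMod 2) = 0 ↔ α = 0 ∨ α = γ) :
    (((indepPairs W).filter fun p => ShiftRelation p (a, b, 0, 0)).card : ℤ) =
      (if γ ∈ W then 1 else 0) * (Nat.card W - 2) := by
  rw [← card_filter_fst_eq_indepPairs W hγ]
  congr 2
  refine Finset.filter_congr fun p hp => ?_
  simp only [ShiftRelation, zero_smul, add_zero, h, (mem_indepPairs.1 hp).1.1, false_or]

open Classical in
theorem card_indepPairs_filter_relation_swap {n : ℕ}
    (W : Submodule (ZMod 2) (Fin (n + 1) → ZMod 2)) (a b c d : ZMod 2) :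
    ((indepPairs W).filter fun p => ShiftRelation p (a, b, c, d)).card =
      ((indepPairs W).filter fun p => ShiftRelation p (c, d, a, b)).card := by
  refine Finset.card_nbij' Prod.swap Prod.swap ?_ ?_ (fun p _ => p.swap_swap)
    fun p _ => p.swap_swap
  all_goals
    rintro ⟨α, β⟩ hp
    rw [Finset.mem_coe, Finset.mem_filter, mem_indepPairs] at hp ⊢
    simp only [ShiftRelation, Prod.swap] at hp ⊢
    refine ⟨⟨⟨hp.1.1.2.1, hp.1.1.1, hp.1.1.2.2.symm⟩, hp.1.2.symm⟩, ?_⟩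
    rw [← hp.2]
    abel

open Classical in
theorem card_indepPairs_filter_relation_add {n : ℕ}
    (W : Submodule (ZMod 2) (Fin (n + 1) → ZMod 2)) (a b c d : ZMod 2) :
    ((indepPairs W).filter fun p => ShiftRelation p (a, b, c, d)).card =
      ((indepPairs W).filter fun p => ShiftRelation p (a + c, b + d, c, d)).card := by
  have hadd : ∀ α β : Fin (n + 1) → ZMod 2, α + (α + β) = β := fun α β => by
    rw [← add_assoc, ZModModule.add_self, zero_add]
  have hinit : ∀ α β : Fin (n + 1) → ZMod 2, (Fin.init (α + β) : Fin n → ZMod 2) =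
    (Fin.init α : Fin n → ZMod 2) + (Fin.init β : Fin n → ZMod 2) := fun _ _ => rfl
  have htail : ∀ α β : Fin (n + 1) → ZMod 2, (Fin.tail (α + β) : Fin n → ZMod 2) =
    (Fin.tail α : Fin n → ZMod 2) + (Fin.tail β : Fin n → ZMod 2) := fun _ _ => rfl
  have hmem : ∀ p ∈ indepPairs W, (p.1, p.1 + p.2) ∈ indepPairs W := fun p hp => by
    rw [mem_indepPairs] at hp ⊢
    refine ⟨⟨hp.1.1, fun h => hp.1.2.2 ?_, fun h => hp.1.2.1 ?_⟩, hp.2.1, add_mem hp.2.1 hp.2.2⟩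
    · change p.1 + p.2 = 0 at h
      rw [← hadd p.1 p.2, h, add_zero]
    · simpa using h
  have key : ∀ (α β : Fin (n + 1) → ZMod 2) (a b : ZMod 2),
      ShiftRelation (α, α + β) (a + c, b + d, c, d) ↔ ShiftRelation (α, β) (a, b, c, d) := by
    intro α β a b
    simp only [ShiftRelation, hinit, htail]
    refine iff_of_eq (congrArg (· = 0) ?_)
    ext i
    simp only [Pi.add_apply, Pi.smul_apply, smul_eq_mul]
    linear_combination (c * (Fin.init α : Fin n → ZMod 2) i + d * (Fin.tail α : Fin n → ZMod 2) i) *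
      (CharTwo.two_eq_zero : (2 : ZMod 2) = 0)
  refine Finset.card_nbij' (fun p => (p.1, p.1 + p.2)) (fun p => (p.1, p.1 + p.2)) ?_ ?_
    (fun p _ => Prod.ext rfl (hadd _ _)) fun p _ => Prod.ext rfl (hadd _ _)
  all_goals
    rintro ⟨α, β⟩ hp
    simp only [Finset.mem_coe, Finset.mem_filter] at hp ⊢
    refine ⟨hmem _ hp.1, ?_⟩
  · exact (key α β a b).2 hp.2
  · rw [← key, hadd]
    exact hp.2

open Classical in
theorem card_indepPairs_filter_relation_shift {n : ℕ}
    {W : Submodule (ZMod 2) (Fin (n + 1) → ZMod 2)} {W' : Submodule (ZMod 2) (Fin (n + 2) → ZMod 2)}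
    (hW : ∀ γ : Fin (n + 2) → ZMod 2, γ ∈ W' ↔
      (Fin.init γ : Fin (n + 1) → ZMod 2) ∈ W ∧ (Fin.tail γ : Fin (n + 1) → ZMod 2) ∈ W) :
    (((indepPairs W).filter fun p => ShiftRelation p (0, 1, 1, 0)).card : ℤ) =
      Nat.card W' - 1 - geometricCount W' := by
  have hcard : ((indepPairs W).filter fun p => ShiftRelation p (0, 1, 1, 0)).card =
      (((((Finset.univ.filter (· ∈ W')).erase 0).erase (Pi.single 0 1)).erase
        (Pi.single (Fin.last (n + 1)) 1)).erase 1).card := by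
    symm
    have hsum : ∀ {v w : Fin n → ZMod 2}, v + w = 0 → v = w := fun h => by
      rwa [add_eq_zero_iff_eq_neg, ZModModule.neg_eq_self] at h
    have hmem : ∀ γ : Fin (n + 2) → ZMod 2, γ ∈ (((((Finset.univ.filter (· ∈ W')).erase 0).erase
        (Pi.single 0 1)).erase (Pi.single (Fin.last (n + 1)) 1)).erase 1) ↔
        ((Fin.init γ : Fin (n + 1) → ZMod 2), (Fin.tail γ : Fin (n + 1) → ZMod 2)) ∈
          indepPairs W := fun γ => by
      simp only [Finset.mem_erase, Finset.mem_filter, Finset.mem_univ, true_and, mem_indepPairs,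
        ne_eq, Fin.init_eq_zero_iff, Fin.tail_eq_zero_iff, Fin.init_eq_tail_iff, hW]
      tauto
    have hinv : ∀ p : (Fin (n + 1) → ZMod 2) × (Fin (n + 1) → ZMod 2),
        ShiftRelation p (0, 1, 1, 0) →
        ((Fin.init (Fin.snoc p.1 (p.2 (Fin.last n)) : Fin (n + 2) → ZMod 2) :
          Fin (n + 1) → ZMod 2), (Fin.tail (Fin.snoc p.1 (p.2 (Fin.last n)) :
          Fin (n + 2) → ZMod 2) : Fin (n + 1) → ZMod 2)) = p := fun p hp => by
      simp only [ShiftRelation, zero_smul, zero_add, one_smul, add_zero] at hp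
      exact Prod.ext (Fin.init_snoc (α := fun _ => ZMod 2) _ _) (Fin.init_snoc_tail (hsum hp))
    refine Finset.card_nbij' (fun γ => (Fin.init γ, Fin.tail γ))
      (fun p => Fin.snoc p.1 (p.2 (Fin.last n))) ?_ ?_ ?_ ?_
    · intro γ hγ
      rw [Finset.mem_coe, hmem] at hγ
      rw [Finset.mem_coe, Finset.mem_filter]
      refine ⟨hγ, ?_⟩
      simp [ShiftRelation, Fin.tail_init_eq_init_tail, ZModModule.add_self]
    · intro p hp
      rw [Finset.mem_coe, Finset.mem_filter] at hp
      rw [Finset.mem_coe, hmem, hinv p hp.2]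
      exact hp.1
    · intro γ _
      exact Fin.snoc_init_self γ
    · intro p hp
      rw [Finset.mem_coe, Finset.mem_filter] at hp
      exact hinv p hp.2
  have h1 : (Pi.single 0 1 : Fin (n + 2) → ZMod 2) ≠ 0 := by simp
  have h2 : (Pi.single (Fin.last (n + 1)) 1 : Fin (n + 2) → ZMod 2) ≠ 0 := by simp
  have h3 : (Pi.single (Fin.last (n + 1)) 1 : Fin (n + 2) → ZMod 2) ≠ Pi.single 0 1 := fun h => by
    simpa using congrFun h 0
  have h4 : (1 : Fin (n + 2) → ZMod 2) ≠ Pi.single 0 1 := fun h => by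
    simpa using congrFun h (Fin.last (n + 1))
  have h5 : (1 : Fin (n + 2) → ZMod 2) ≠ Pi.single (Fin.last (n + 1)) 1 := fun h => by
    simpa [Fin.ext_iff] using congrFun h 0
  rw [hcard]
  simp only [Finset.intCast_card_erase, Finset.mem_erase, Finset.mem_filter, Finset.mem_univ,
    true_and, ne_eq, h1, h2, h3, h4, h5, not_false_eq_true, one_ne_zero, zero_mem, if_true,
    geometricCount]
  rw [Nat.card_eq_fintype_card, Fintype.card_subtype]
  ring

theorem geometricCount_eq_of_mem_iff {n : ℕ} {W : Submodule (ZMod 2) (Fin (n + 1) → ZMod 2)}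
    {W' : Submodule (ZMod 2) (Fin (n + 2) → ZMod 2)}
    (hW : ∀ γ : Fin (n + 2) → ZMod 2, γ ∈ W' ↔
      (Fin.init γ : Fin (n + 1) → ZMod 2) ∈ W ∧ (Fin.tail γ : Fin (n + 1) → ZMod 2) ∈ W) :
    geometricCount W' = geometricCount W := by
  classical
  have h1 : (Fin.init (Pi.single 0 1 : Fin (n + 2) → ZMod 2) : Fin (n + 1) → ZMod 2) =
      Pi.single 0 1 := by
    ext i
    refine Fin.cases ?_ (fun j => ?_) i <;> simp [Fin.init]
  have h2 : (Fin.tail (Pi.single (Fin.last (n + 1)) 1 : Fin (n + 2) → ZMod 2) :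
      Fin (n + 1) → ZMod 2) = Pi.single (Fin.last n) 1 := by
    ext i
    simp [Fin.tail, Pi.single_apply, Fin.ext_iff]
  have h3 : (Fin.tail (1 : Fin (n + 2) → ZMod 2) : Fin (n + 1) → ZMod 2) = 1 := rfl
  have h4 : (Fin.init (1 : Fin (n + 2) → ZMod 2) : Fin (n + 1) → ZMod 2) = 1 := rfl
  have h5 := Fin.tail_eq_zero_iff.2 (Or.inr (rfl : (Pi.single 0 1 : Fin (n + 2) → ZMod 2) = _))
  have h6 := Fin.init_eq_zero_iff.2
    (Or.inr (rfl : (Pi.single (Fin.last (n + 1)) 1 : Fin (n + 2) → ZMod 2) = _))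
  simp only [geometricCount, hW, h1, h2, h3, h4, h5, h6, zero_mem, true_and, and_true, and_self]

theorem sum_card_shiftRelation {n : ℕ} {W : Submodule (ZMod 2) (Fin (n + 1) → ZMod 2)}
    {W' : Submodule (ZMod 2) (Fin (n + 2) → ZMod 2)}
    (hW : ∀ γ : Fin (n + 2) → ZMod 2, γ ∈ W' ↔
      (Fin.init γ : Fin (n + 1) → ZMod 2) ∈ W ∧ (Fin.tail γ : Fin (n + 1) → ZMod 2) ∈ W) :
    ∑ p ∈ indepPairs W, ((Nat.card {r // ShiftRelation p r} : ℤ) - 1) =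
      6 * (Nat.card W' - 1) + 3 * (Nat.card W - 4) * geometricCount W := by
  classical
  let c : ZMod 2 × ZMod 2 × ZMod 2 × ZMod 2 → ℤ := fun r =>
    (((indepPairs W).filter fun p => ShiftRelation p r).card : ℤ)
  have hsum : ∑ p ∈ indepPairs W, (Nat.card {r // ShiftRelation p r} : ℤ) = ∑ r, c r := by
    simp only [c, Finset.card_filter, Nat.cast_sum]
    rw [Finset.sum_comm]
    refine Finset.sum_congr rfl fun p _ => ?_
    rw [Nat.card_eq_fintype_card, Fintype.card_subtype, Finset.card_filter, Nat.cast_sum]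
  have hsum2 : ∀ f : ZMod 2 → ℤ, ∑ x, f x = f 0 + f 1 := Fin.sum_univ_two
  have hswap : ∀ x y z w, c (x, y, z, w) = c (z, w, x, y) := fun x y z w =>
    congrArg Nat.cast (card_indepPairs_filter_relation_swap W x y z w)
  have hadd : ∀ x y z w, c (x, y, z, w) = c (x + z, y + w, z, w) := fun x y z w =>
    congrArg Nat.cast (card_indepPairs_filter_relation_add W x y z w)
  have hzero : c (0, 0, 0, 0) = (indepPairs W).card := by
    simp only [c, ShiftRelation, zero_smul, add_zero, Finset.filter_true]
  have hinit := card_indepPairs_filter_relation_fst W (a := 1) (b := 0)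
    (γ := Pi.single (Fin.last n) 1) (by simp) fun α => by
      rw [one_smul, zero_smul, add_zero, Fin.init_eq_zero_iff]
  have htail := card_indepPairs_filter_relation_fst W (a := 0) (b := 1)
    (γ := Pi.single 0 1) (by simp) fun α => by
      rw [one_smul, zero_smul, zero_add, Fin.tail_eq_zero_iff]
  have hdiff := card_indepPairs_filter_relation_fst W (a := 1) (b := 1)
    (γ := 1) one_ne_zero fun α => by
      rw [one_smul, one_smul, add_eq_zero_iff_eq_neg, ZModModule.neg_eq_self,
        Fin.init_eq_tail_iff]
  have hshift := card_indepPairs_filter_relation_shift hW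
  rw [geometricCount_eq_of_mem_iff hW] at hshift
  change c _ = _ at hinit htail hdiff hshift
  have e1 := hswap 1 0 0 0
  have e2 := hswap 0 1 0 0
  have e3 := hswap 1 1 0 0
  have e4 := hadd 0 0 1 0
  have e5 := hadd 0 0 0 1
  have e6 := hadd 0 0 1 1
  have e7 := hadd 0 1 1 0
  have e8 := hswap 0 1 1 0
  have e9 := hadd 1 0 0 1
  have e10 := hswap 1 1 1 0
  have e11 := hswap 1 1 0 1
  simp only [zero_add, add_zero] at e4 e5 e6 e7 e9
  rw [Finset.sum_sub_distrib, hsum, Finset.sum_const, nsmul_eq_mul, mul_one]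
  simp only [Fintype.sum_prod_type, hsum2]
  rw [geometricCount] at hshift ⊢
  linear_combination hzero + 6 * hshift + 3 * hinit + 3 * htail + 3 * hdiff - 2 * e1 - 2 * e2 -
    2 * e3 - e4 - e5 - e6 - 2 * e7 - 3 * e8 - 2 * e9 - e10 - e11

section

open Polynomial

theorem X_pow_mul_mem_degreeLT {K : Type*} [Field K] {m j : ℕ} {f : K[X]}
    (hf : f ∈ degreeLT K m) : X ^ j * f ∈ degreeLT K (j + m) := by
  induction j with
  | zero => simpa using hf
  | succ j ih =>
    rw [pow_succ', mul_assoc, add_right_comm]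
    exact X_mul_mem_degreeLT_succ.2 ih

/-- The sequences of length `N` which satisfy the linear recurrence `f` of length `m`. -/
def solutions {K : Type*} [Field K] (N m : ℕ) (f : K[X]) : Submodule K (Fin N → K) where
  carrier := {α | ∀ j, j + m ≤ N → moment α (X ^ j * f) = 0}
  add_mem' := fun ha hb j hj => by
    have h1 := ha j hj
    have h2 := hb j hj
    rw [moment_apply] at h1 h2 ⊢
    simp only [Pi.add_apply, add_mul, Finset.sum_add_distrib, h1, h2, add_zero]
  zero_mem' := fun j _ => by simp [moment_apply]
  smul_mem' := fun c α ha j hj => by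
    have h := ha j hj
    rw [moment_apply] at h ⊢
    simp only [Pi.smul_apply, smul_eq_mul, mul_assoc, ← Finset.mul_sum, h, mul_zero]

theorem mem_solutions {K : Type*} [Field K] {N m : ℕ} {f : K[X]} {α : Fin N → K} :
    α ∈ solutions N m f ↔ ∀ j, j + m ≤ N → moment α (X ^ j * f) = 0 := Iff.rfl

theorem mem_solutions_succ {K : Type*} [Field K] {N m : ℕ} {f : K[X]} (hf : f ∈ degreeLT K m)
    (hm : m ≤ N) (α : Fin (N + 1) → K) :
    α ∈ solutions (N + 1) m f ↔ (Fin.init α : Fin N → K) ∈ solutions N m f ∧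
      (Fin.tail α : Fin N → K) ∈ solutions N m f := by
  simp only [mem_solutions]
  constructor
  · refine fun h => ⟨fun j hj => ?_, fun j hj => ?_⟩
    · rw [moment_init _ (degreeLT_mono hj (X_pow_mul_mem_degreeLT hf))]
      exact h j (by omega)
    · rw [moment_tail, ← mul_assoc, ← pow_succ']
      exact h (j + 1) (by omega)
  · rintro ⟨h1, h2⟩ (_ | j) hj
    · rw [← moment_init _ (degreeLT_mono (by omega) (X_pow_mul_mem_degreeLT hf))]
      exact h1 0 (by omega)
    · rw [pow_succ', mul_assoc, ← moment_tail]
      exact h2 j (by omega)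

theorem finrank_solutions {K : Type*} [Field K] {N m : ℕ} {f : K[X]} (hf : f ∈ degreeLT K m)
    (h0 : f ≠ 0) (hm : m ≤ N + 1) : Module.finrank K (solutions N m f) + 1 = m := by
  let B : Matrix (Fin (N + 1 - m)) (Fin N) K := Matrix.of fun j i => (X ^ (j : ℕ) * f).coeff i
  have hli : LinearIndependent K B.row := by
    refine Fintype.linearIndependent_iff.2 fun g hg j => ?_
    let P : K[X] := ∑ j : Fin (N + 1 - m), C (g j) * X ^ (j : ℕ)
    have hP : P * f = 0 := by
      have hdeg : P * f ∈ degreeLT K N := by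
        rw [Finset.sum_mul]
        refine sum_mem fun j _ => ?_
        rw [mul_assoc, ← smul_eq_C_mul]
        exact Submodule.smul_mem _ _ (degreeLT_mono (by omega) (X_pow_mul_mem_degreeLT hf))
      ext i
      rcases lt_or_ge i N with hi | hi
      · have := congrFun hg ⟨i, hi⟩
        simp only [Finset.sum_apply, Pi.smul_apply, Pi.zero_apply, smul_eq_mul, Matrix.row,
          Matrix.of_apply, B] at this
        rw [Finset.sum_mul, finsetSum_coeff, coeff_zero, ← this]
        simp only [mul_assoc, coeff_C_mul]
      · exact coeff_eq_zero_of_degree_lt ((mem_degreeLT.1 hdeg).trans_le (by exact_mod_cast hi))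
    have hP0 := (mul_eq_zero.1 hP).resolve_right h0
    have := congrArg (coeff · j) hP0
    simpa [P, finsetSum_coeff, coeff_X_pow, ← Fin.ext_iff] using this
  have hrank := hli.rank_matrix
  rw [Fintype.card_fin] at hrank
  have hker : solutions N m f = LinearMap.ker B.mulVecLin := by
    ext α
    rw [mem_solutions, LinearMap.mem_ker, Matrix.mulVecLin_apply, funext_iff]
    have key : ∀ j : Fin (N + 1 - m), (B *ᵥ α) j = moment α (X ^ (j : ℕ) * f) := fun j => by
      rw [moment_apply, Matrix.mulVec, dotProduct]
      exact Finset.sum_congr rfl fun i _ => mul_comm ((X ^ (j : ℕ) * f).coeff i) (α i)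
    simp only [key, Pi.zero_apply]
    exact ⟨fun h j => h j (by omega), fun h j hj => h ⟨j, by omega⟩⟩
  have hdim := B.mulVecLin.finrank_range_add_finrank_ker
  rw [Module.finrank_fin_fun, ← hker] at hdim
  rw [Matrix.rank] at hrank
  have hm0 : m ≠ 0 := by
    rintro rfl
    exact h0 (by simpa [mem_degreeLT] using hf)
  omega

theorem natCard_solutions {N m : ℕ} {f : (ZMod 2)[X]} (hf : f ∈ degreeLT (ZMod 2) (m + 1))
    (h0 : f ≠ 0) (hm : m ≤ N) : Nat.card (solutions N (m + 1) f) = 2 ^ m := by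
  have h1 := finrank_solutions hf h0 (by omega : m + 1 ≤ N + 1)
  have h2 := Module.natCard_eq_pow_finrank (K := ZMod 2) (V := solutions N (m + 1) f)
  rwa [Nat.card_zmod, Nat.succ_injective h1] at h2

noncomputable instance (m : ℕ) : Fintype (degreeLT (ZMod 2) m) :=
  have : Finite (degreeLT (ZMod 2) m) := Module.finite_of_finite (ZMod 2)
  Fintype.ofFinite _

theorem card_degreeLT (m : ℕ) : Fintype.card (degreeLT (ZMod 2) m) = 2 ^ m := by
  rw [Module.card_eq_pow_finrank (K := ZMod 2), ZMod.card,
    LinearEquiv.finrank_eq (degreeLTEquiv (ZMod 2) m), Module.finrank_fin_fun]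

open Classical in
theorem sum_indepPairs_mul {N : ℕ} (m : ℕ)
    (w : (Fin N → ZMod 2) × (Fin N → ZMod 2) → ℤ) :
    ∑ p ∈ indepPairs ⊤, w p *
        ((2 : ℤ) ^ Module.finrank (ZMod 2) (commonRecurrences p.1 p.2 m) - 1) =
      ∑ f ∈ (Finset.univ : Finset (degreeLT (ZMod 2) m)).erase 0,
        ∑ p ∈ indepPairs (solutions N m (f : (ZMod 2)[X])), w p := by
  have hcard : ∀ p : (Fin N → ZMod 2) × (Fin N → ZMod 2),
      (2 : ℤ) ^ Module.finrank (ZMod 2) (commonRecurrences p.1 p.2 m) - 1 =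
      ∑ f ∈ (Finset.univ : Finset (degreeLT (ZMod 2) m)).erase 0,
        if p.1 ∈ solutions N m (f : (ZMod 2)[X]) ∧ p.2 ∈ solutions N m (f : (ZMod 2)[X])
          then 1 else 0 := by
    intro p
    have hpow := Module.natCard_eq_pow_finrank (K := ZMod 2) (V := commonRecurrences p.1 p.2 m)
    rw [Nat.card_zmod] at hpow
    have hequiv : Nat.card (commonRecurrences p.1 p.2 m) =
        Nat.card {f : degreeLT (ZMod 2) m // p.1 ∈ solutions N m (f : (ZMod 2)[X]) ∧
          p.2 ∈ solutions N m (f : (ZMod 2)[X])} := by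
      refine Nat.card_congr
        { toFun := fun f => ⟨⟨f.1, f.2.1.1⟩, f.2.1.2, f.2.2.2⟩
          invFun := fun f => ⟨f.1.1, ⟨f.1.2, f.2.1⟩, f.1.2, f.2.2⟩
          left_inv := fun f => rfl
          right_inv := fun f => rfl }
    rw [hpow, Nat.card_eq_fintype_card, Fintype.card_subtype] at hequiv
    rw [Finset.sum_erase_eq_sub (Finset.mem_univ _), Finset.sum_boole, ← hequiv]
    simp [mem_solutions]
  simp only [hcard, Finset.mul_sum]
  rw [Finset.sum_comm]
  refine Finset.sum_congr rfl fun f _ => ?_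
  simp only [mul_ite, mul_one, mul_zero]
  rw [← Finset.sum_filter]
  refine Finset.sum_congr ?_ fun _ _ => rfl
  ext p
  simp only [Finset.mem_filter, mem_indepPairs, Submodule.mem_top, and_self, and_true]

theorem sum_ite_eq_zero_of_ne_zero {m : ℕ} {φ : degreeLT (ZMod 2) (m + 1) →ₗ[ZMod 2] ZMod 2}
    (hφ : φ ≠ 0) : ∑ f ∈ (Finset.univ : Finset (degreeLT (ZMod 2) (m + 1))).erase 0,
      (if φ f = 0 then (1 : ℤ) else 0) = 2 ^ m - 1 := by
  have h1 := Module.Dual.finrank_ker_add_one_of_ne_zero hφ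
  rw [LinearEquiv.finrank_eq (degreeLTEquiv (ZMod 2) (m + 1)), Module.finrank_fin_fun] at h1
  have h2 := Module.natCard_eq_pow_finrank (K := ZMod 2) (V := LinearMap.ker φ)
  rw [Nat.card_zmod, Nat.succ_injective h1] at h2
  rw [Finset.sum_erase_eq_sub (Finset.mem_univ _), Finset.sum_boole, ← Fintype.card_subtype,
    ← Nat.card_eq_fintype_card]
  simp only [map_zero, if_true, sub_left_inj]
  exact_mod_cast h2

theorem moment_single {K : Type*} [Field K] {N : ℕ} (i : Fin N) (p : K[X]) :
    moment (Pi.single i 1) p = p.coeff i := by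
  simp [moment_apply, Pi.single_apply]

theorem single_zero_mem_solutions {K : Type*} [Field K] {n m : ℕ} {f : K[X]} (hm : m ≤ n + 1) :
    Pi.single 0 1 ∈ solutions (n + 1) m f ↔ f.coeff 0 = 0 := by
  simp only [mem_solutions, moment_single]
  refine ⟨fun h => by simpa using h 0 (by omega), ?_⟩
  rintro h (_ | j) _
  · simpa using h
  · simp [mul_coeff_zero]

theorem single_last_mem_solutions {K : Type*} [Field K] {n m : ℕ} {f : K[X]}
    (hf : f ∈ degreeLT K (m + 1)) (hm : m ≤ n) :
    Pi.single (Fin.last n) 1 ∈ solutions (n + 1) (m + 1) f ↔ f.coeff m = 0 := by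
  simp only [mem_solutions, moment_single, Fin.val_last]
  constructor
  · intro h
    have := h (n - m) (by omega)
    rwa [coeff_X_pow_mul', if_pos (by omega), Nat.sub_sub_self hm] at this
  · intro h j hj
    rw [coeff_X_pow_mul', if_pos (by omega)]
    rcases (by omega : m = n - j ∨ m + 1 ≤ n - j) with h' | h'
    · rwa [← h']
    · exact coeff_eq_zero_of_degree_lt ((mem_degreeLT.1 hf).trans_le (by exact_mod_cast h'))

theorem one_mem_solutions {K : Type*} [Field K] {N m : ℕ} {f : K[X]}
    (hf : f ∈ degreeLT K m) (hm : m ≤ N) :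
    (1 : Fin N → K) ∈ solutions N m f ↔ f.eval 1 = 0 := by
  have key : ∀ j, j + m ≤ N → moment (1 : Fin N → K) (X ^ j * f) = f.eval 1 := fun j hj => by
    have h1 : (X ^ j * f).natDegree < N ∨ X ^ j * f = 0 := by
      have := mem_degreeLT.1 (degreeLT_mono hj (X_pow_mul_mem_degreeLT (j := j) hf))
      by_cases h0 : X ^ j * f = 0
      · exact Or.inr h0
      · exact Or.inl ((natDegree_lt_iff_degree_lt h0).2 this)
    have h2 : (X ^ j * f).eval 1 = f.eval 1 := by simp
    rw [← h2]
    rcases h1 with h1 | h1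
    · rw [eval_eq_sum_range' h1, moment_apply, Finset.sum_range]
      simp
    · simp [h1]
  exact ⟨fun h => (key 0 (by omega)).symm.trans (h 0 (by omega)),
    fun h j hj => (key j hj).trans h⟩

theorem sum_geometricCount_solutions {n m : ℕ} (hm : m ≤ n) :
    ∑ f ∈ (Finset.univ : Finset (degreeLT (ZMod 2) (m + 1))).erase 0,
      geometricCount (solutions (n + 1) (m + 1) (f : (ZMod 2)[X])) = 3 * (2 ^ m - 1) := by
  classical
  have hone : (1 : (ZMod 2)[X]) ∈ degreeLT (ZMod 2) (m + 1) := by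
    rw [mem_degreeLT, degree_one]
    exact_mod_cast Nat.succ_pos m
  have hX : (X ^ m : (ZMod 2)[X]) ∈ degreeLT (ZMod 2) (m + 1) := by
    rw [mem_degreeLT, degree_X_pow]
    exact_mod_cast Nat.lt_succ_self m
  have h1 := sum_ite_eq_zero_of_ne_zero
    (φ := (lcoeff (ZMod 2) 0).comp (degreeLT (ZMod 2) (m + 1)).subtype) fun h => by
      simpa using LinearMap.congr_fun h ⟨1, hone⟩
  have h2 := sum_ite_eq_zero_of_ne_zero
    (φ := (lcoeff (ZMod 2) m).comp (degreeLT (ZMod 2) (m + 1)).subtype) fun h => by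
      simpa using LinearMap.congr_fun h ⟨X ^ m, hX⟩
  have h3 := sum_ite_eq_zero_of_ne_zero
    (φ := (leval (1 : ZMod 2)).comp (degreeLT (ZMod 2) (m + 1)).subtype) fun h => by
      simpa using LinearMap.congr_fun h ⟨1, hone⟩
  simp only [LinearMap.comp_apply, Submodule.subtype_apply, lcoeff_apply, leval_apply] at h1 h2 h3
  simp only [geometricCount, single_zero_mem_solutions (Nat.succ_le_succ hm),
    single_last_mem_solutions (Subtype.prop _) hm,
    one_mem_solutions (Subtype.prop _) (Nat.succ_le_succ hm), Finset.sum_add_distrib]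
  rw [show (3 : ℤ) * (2 ^ m - 1) = 2 ^ m - 1 + (2 ^ m - 1) + (2 ^ m - 1) by ring]
  convert congrArg₂ (· + ·) (congrArg₂ (· + ·) h1 h2) h3
  all_goals congr

theorem sum_two_pow_finrank_commonRecurrences {N m : ℕ} (hm : m ≤ N) :
    ∑ p ∈ indepPairs (⊤ : Submodule (ZMod 2) (Fin N → ZMod 2)),
        ((2 : ℤ) ^ Module.finrank (ZMod 2) (commonRecurrences p.1 p.2 (m + 1)) - 1) =
      (2 ^ (m + 1) - 1) * ((2 ^ m - 1) * (2 ^ m - 2)) := by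
  have h := sum_indepPairs_mul (N := N) (m + 1) fun _ => 1
  simp only [one_mul, Finset.sum_const, nsmul_eq_mul, mul_one] at h
  rw [h, Finset.sum_congr rfl fun f hf => by
    rw [card_indepPairs, natCard_solutions f.2 (by simpa using Finset.ne_of_mem_erase hf) hm]]
  rw [Finset.sum_const, nsmul_eq_mul, Finset.intCast_card_erase, Finset.card_univ, card_degreeLT,
    if_pos (Finset.mem_univ _)]
  push_cast
  ring

theorem sum_card_shiftRelation_mul {n m : ℕ} (hm : m ≤ n) :
    ∑ p ∈ indepPairs (⊤ : Submodule (ZMod 2) (Fin (n + 1) → ZMod 2)),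
        ((Nat.card {r // ShiftRelation p r} : ℤ) - 1) *
        ((2 : ℤ) ^ Module.finrank (ZMod 2) (commonRecurrences p.1 p.2 (m + 1)) - 1) =
      21 * ((2 ^ m - 1) * (2 ^ m - 2)) := by
  rw [sum_indepPairs_mul, Finset.sum_congr rfl fun f hf => by
    rw [sum_card_shiftRelation (mem_solutions_succ f.2 (Nat.succ_le_succ hm)),
      natCard_solutions f.2 (by simpa using Finset.ne_of_mem_erase hf) (by omega),
      natCard_solutions f.2 (by simpa using Finset.ne_of_mem_erase hf) (by omega)]]
  rw [Finset.sum_add_distrib, ← Finset.mul_sum, ← Finset.mul_sum, sum_geometricCount_solutions hm,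
    Finset.sum_const,
    nsmul_eq_mul, Finset.intCast_card_erase, Finset.card_univ, card_degreeLT,
    if_pos (Finset.mem_univ _)]
  push_cast
  ring

theorem sum_card_shiftRelation_top (n : ℕ) :
    ∑ p ∈ indepPairs (⊤ : Submodule (ZMod 2) (Fin (n + 1) → ZMod 2)),
        ((Nat.card {r // ShiftRelation p r} : ℤ) - 1) = 21 * 2 ^ (n + 1) - 42 := by
  have hcard : ∀ N : ℕ, Nat.card (⊤ : Submodule (ZMod 2) (Fin N → ZMod 2)) = 2 ^ N := fun N => by
    rw [Nat.card_congr Submodule.topEquiv.toEquiv]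
    simp
  rw [sum_card_shiftRelation (W' := ⊤) (by simp), hcard, hcard, geometricCount]
  simp only [Submodule.mem_top, if_true]
  push_cast
  ring

end

theorem ite_finrank_commonRecurrences_eq {n s k : ℕ} (hs : 2 ≤ s) (hk : s + 2 ≤ k)
    (hn : s + k = n + 2) {p : (Fin (n + 1) → ZMod 2) × (Fin (n + 1) → ZMod 2)}
    (hp : IsIndepPair p) (A : ℕ → ℤ)
    (hA : ∀ m, A m = 2 ^ Module.finrank (ZMod 2) (commonRecurrences p.1 p.2 m) - 1) :
    (if Module.finrank (ZMod 2) (commonRecurrences p.1 p.2 k) + (s + 1) = k then (1 : ℤ) else 0) =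
      A (s + 2) - 3 * A (s + 1) + 2 * A s + ((Nat.card {r // ShiftRelation p r} : ℤ) - 1) -
        ((Nat.card {r // ShiftRelation p r} : ℤ) - 1) * A (s + 2) +
        2 * (((Nat.card {r // ShiftRelation p r} : ℤ) - 1) * A (s + 1)) := by
  let d : ℕ → ℕ := fun m => Module.finrank (ZMod 2) (commonRecurrences p.1 p.2 m)
  let i : ℕ → ℤ := fun m => (d m : ℤ)
  have hi : ∀ m, m + 1 ≤ n + 1 → 2 * i (m + 1) ≤ i (m + 2) + i m := fun m hm => by
    have := finrank_commonRecurrences_convex p.1 p.2 hm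
    simp only [i, d]
    omega
  have hnn : ∀ m, 0 ≤ i m := fun m => Int.natCast_nonneg _
  have h0 : i 0 = 0 := by simp [i, d, commonRecurrences_zero]
  have hiN : i (n + 1) = ((n + 1 : ℕ) : ℤ) - 2 := by
    have := finrank_commonRecurrences_self hp
    simp only [i, d]
    omega
  have hcond : Module.finrank (ZMod 2) (commonRecurrences p.1 p.2 k) + (s + 1) = k ↔
      i k = k - s - 1 := by
    simp only [i, d]
    omega
  have hstep : ∀ m, i (m + 1) = i m + 1 → A (m + 1) - 2 * A m = 1 := fun m hm => by
    have hd : d (m + 1) = d m + 1 := Int.natCast_inj.1 hm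
    rw [hA, hA, show Module.finrank (ZMod 2) (commonRecurrences p.1 p.2 (m + 1)) = _ from hd]
    ring
  have hA0 : ∀ m, i m = 0 → A m = 0 := fun m hm => by
    have hd : d m = 0 := Int.natCast_eq_zero.1 hm
    rw [hA, show Module.finrank (ZMod 2) (commonRecurrences p.1 p.2 m) = _ from hd]
    simp
  simp only [hcond]
  rcases Int.eq_zero_or_eq_add_one_of_convex (m := s + 1) hi h0 hnn (by omega) (by omega) hiN with
    ⟨h1, h2⟩ | h2
  · have h3 : i s = 0 := by
      rcases Int.eq_zero_or_eq_add_one_of_convex (m := s) hi h0 hnn (by omega) (by omega) hiN with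
        h | h
      · exact h.1
      · have := hnn s
        omega
    rw [hA0 _ h1, hA0 _ h2, hA0 _ h3]
    obtain ⟨e, he, hcard⟩ := exists_card_shiftRelation p
    rw [hcard]
    have he' : i n + 4 = n + e := by
      simp only [i, d]
      omega
    rcases Int.dichotomy_of_convex hi hs hk hn hiN h2 (by push_cast; simp; omega) with h | h
    · obtain rfl : e = 1 := by
        have := h.2
        simp only [Nat.add_sub_cancel] at this
        omega
      simp [h.1]
    · obtain rfl : e = 0 := by
        have := h.2
        simp only [Nat.add_sub_cancel] at this
        omega
      simp [h.1]
  · have h3 := hstep (s + 1) h2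
    have h4 : i k = k - s - 1 ↔ i (s + 1) = 0 :=
      Int.eq_iff_of_convex_of_pos hi h0 hnn hs hk hn hiN <| by
        have := hnn (s + 1)
        change 0 < i (s + 1 + 1)
        omega
    simp only [h4]
    rcases Int.eq_zero_or_eq_add_one_of_convex (m := s) hi h0 hnn (by omega) (by omega) hiN with
      ⟨h5, h6⟩ | h6
    · rw [if_pos h6]
      have h7 := hA0 _ h5
      have h8 := hA0 _ h6
      linear_combination (((Nat.card {r // ShiftRelation p r} : ℤ) - 1) - 1) * h3 + h8 - 2 * h7
    · rw [if_neg (by have := hnn s; omega)]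
      have h7 := hstep s h6
      linear_combination (((Nat.card {r // ShiftRelation p r} : ℤ) - 1) - 1) * h3 + h7

theorem sum_ite_finrank_commonRecurrences {n s k : ℕ} (hs : 2 ≤ s) (hk : s + 2 ≤ k)
    (hn : s + k = n + 2) :
    ∑ p ∈ indepPairs (⊤ : Submodule (ZMod 2) (Fin (n + 1) → ZMod 2)),
        (if Module.finrank (ZMod 2) (commonRecurrences p.1 p.2 k) + (s + 1) = k
          then (1 : ℤ) else 0) =
      21 * (2 ^ (k + s - 1) + 2 ^ (3 * s - 1) - 5 * 2 ^ (2 * s - 1)) := by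
  rw [Finset.sum_congr rfl fun p hp =>
    ite_finrank_commonRecurrences_eq hs hk hn (mem_indepPairs.1 hp).1 _ fun _ => rfl]
  rw [Finset.sum_add_distrib, Finset.sum_sub_distrib, Finset.sum_add_distrib,
    Finset.sum_add_distrib, Finset.sum_sub_distrib, ← Finset.mul_sum, ← Finset.mul_sum,
    ← Finset.mul_sum]
  obtain ⟨t, rfl⟩ : ∃ t, s = t + 1 := ⟨s - 1, by omega⟩
  rw [sum_two_pow_finrank_commonRecurrences (m := t + 2) (by omega),
    sum_two_pow_finrank_commonRecurrences (m := t + 1) (by omega),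
    sum_two_pow_finrank_commonRecurrences (m := t) (by omega),
    sum_card_shiftRelation_mul (m := t + 2) (by omega),
    sum_card_shiftRelation_mul (m := t + 1) (by omega), sum_card_shiftRelation_top,
    show k + (t + 1) - 1 = n + 1 by omega,
    show 3 * (t + 1) - 1 = 3 * t + 2 by omega, show 2 * (t + 1) - 1 = 2 * t + 1 by omega]
  ring

theorem Gamma_self_succ_eq_sum {s k : ℕ} (hs : 0 < s) :
    (Gamma s s k (s + 1) : ℤ) =
      ∑ p ∈ indepPairs (⊤ : Submodule (ZMod 2) (Fin (s + k - 1) → ZMod 2)),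
        if Module.finrank (ZMod 2) (commonRecurrences p.1 p.2 k) + (s + 1) = k
          then (1 : ℤ) else 0 := by
  classical
  rw [Finset.sum_boole, Gamma, Nat.card_eq_fintype_card, Fintype.card_subtype]
  congr 2
  ext p
  have hrank := finrank_commonRecurrences_add_rank_fromRows (k := k) hs p.1 p.2
  simp only [Finset.mem_filter, Finset.mem_univ, true_and, mem_indepPairs, Submodule.mem_top,
    and_true]
  constructor
  · intro h
    refine ⟨?_, h ▸ hrank⟩
    by_contra hp
    have := rank_fromRows_hankel_le_of_not_isIndepPair (k := k) hs (α := p.1) (β := p.2) hp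
    omega
  · rintro ⟨-, h⟩
    omega

theorem Gamma_s_add_one_square_case (s k : ℕ) (hs : 2 ≤ s) (hk : s + 1 < k) :
    (Gamma s s k (s + 1) : ℤ) = 21 * (2 ^ (k + s - 1) + 2 ^ (3 * s - 1) - 5 * 2 ^ (2 * s - 1)) := by
  obtain ⟨n, hn⟩ : ∃ n, s + k - 1 = n + 1 := ⟨s + k - 2, by omega⟩
  rw [Gamma_self_succ_eq_sum (by omega), hn]
  exact sum_ite_finrank_commonRecurrences hs hk (by omega)
end

section
/- Let s ≥ 2 and k > 2s. Then Γ_{2s}^{[s,s]×k} = 2^{2k+2s−2} − 3·2^{k+4s−4} + 2^{6s−5}; i.e. the number of pairs (α,β) ∈ F_2^{s+k−1} × F_2^{s+k−1} whose stacked 2s×k double Hankel matrix has full rank 2s equals 2^{2k+2s−2} − 3·2^{k+4s−4} + 2^{6s−5}. -/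
open Matrix

section PolynomialKernels

open Polynomial Module

variable {F : Type*} [Field F]

/-- The polynomial with prescribed coefficients in degrees `< k`. -/
noncomputable def ofCoeffs (F : Type*) [Field F] (k : ℕ) : (Fin k → F) →ₗ[F] F[X] :=
  (degreeLT F k).subtype ∘ₗ (degreeLTEquiv F k).symm.toLinearMap

lemma ofCoeffs_apply (k : ℕ) (c : Fin k → F) :
    ofCoeffs F k c = ∑ j, c j • (X : F[X]) ^ (j : ℕ) := by
  simp [ofCoeffs, degreeLTEquiv, ← C_mul_X_pow_eq_monomial, smul_eq_C_mul]

lemma ofCoeffs_injective (k : ℕ) : Function.Injective (ofCoeffs F k) :=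
  Subtype.val_injective.comp (degreeLTEquiv F k).symm.injective

lemma range_ofCoeffs (k : ℕ) : LinearMap.range (ofCoeffs F k) = degreeLT F k := by
  simp [ofCoeffs, LinearMap.range_comp]

lemma ofCoeffs_mem (k : ℕ) (c : Fin k → F) : ofCoeffs F k c ∈ degreeLT F k := by
  rw [← range_ofCoeffs]; exact ⟨c, rfl⟩

/-- The stacked Hankel matrix of the moment sequences of two functionals on `F[X]`. -/
noncomputable def stackedHankel (A B : Dual F F[X]) (s k : ℕ) : Matrix (Fin s ⊕ Fin s) (Fin k) F :=
  Matrix.fromRows (Matrix.of fun i j => A (X ^ ((i : ℕ) + (j : ℕ))))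
    (Matrix.of fun i j => B (X ^ ((i : ℕ) + (j : ℕ))))

/-- The right kernel of the stacked Hankel matrix, as a space of polynomials. -/
def rightKer (A B : Dual F F[X]) (s k : ℕ) : Submodule F F[X] where
  carrier := {f | f ∈ degreeLT F k ∧ ∀ i < s, A (X ^ i * f) = 0 ∧ B (X ^ i * f) = 0}
  add_mem' := fun hf hg => ⟨add_mem hf.1 hg.1, fun i hi => by
    simp [mul_add, hf.2 i hi, hg.2 i hi]⟩
  zero_mem' := by simp
  smul_mem' := fun c f hf => ⟨Submodule.smul_mem _ _ hf.1, fun i hi => by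
    simp [hf.2 i hi]⟩

/-- The left kernel of the stacked Hankel matrix, as a space of pairs of polynomials. -/
def leftKer (A B : Dual F F[X]) (s k : ℕ) : Submodule F (F[X] × F[X]) where
  carrier := {z | (z.1 ∈ degreeLT F s ∧ z.2 ∈ degreeLT F s) ∧
    ∀ j < k, A (X ^ j * z.1) + B (X ^ j * z.2) = 0}
  add_mem' := fun {y z} hy hz => ⟨⟨add_mem hy.1.1 hz.1.1, add_mem hy.1.2 hz.1.2⟩, fun j hj => by
    have h1 := hy.2 j hj
    have h2 := hz.2 j hj
    simp only [Prod.fst_add, Prod.snd_add, mul_add, map_add]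
    linear_combination h1 + h2⟩
  zero_mem' := by simp
  smul_mem' := fun c z hz => ⟨⟨Submodule.smul_mem _ _ hz.1.1, Submodule.smul_mem _ _ hz.1.2⟩,
    fun j hj => by
      have h := hz.2 j hj
      simp only [Prod.smul_fst, Prod.smul_snd, mul_smul_comm, map_smul, smul_eq_mul]
      linear_combination c * h⟩

lemma mem_rightKer {A B : Dual F F[X]} {s k : ℕ} {f : F[X]} :
    f ∈ rightKer A B s k ↔
      f ∈ degreeLT F k ∧ ∀ i < s, A (X ^ i * f) = 0 ∧ B (X ^ i * f) = 0 := Iff.rfl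

lemma mem_leftKer {A B : Dual F F[X]} {s k : ℕ} {z : F[X] × F[X]} :
    z ∈ leftKer A B s k ↔ (z.1 ∈ degreeLT F s ∧ z.2 ∈ degreeLT F s) ∧
      ∀ j < k, A (X ^ j * z.1) + B (X ^ j * z.2) = 0 := Iff.rfl

lemma apply_X_pow_mul_ofCoeffs (A : Dual F F[X]) (i k : ℕ) (c : Fin k → F) :
    A (X ^ i * ofCoeffs F k c) = ∑ j : Fin k, A (X ^ (i + (j : ℕ))) * c j := by
  simp [ofCoeffs_apply, Finset.mul_sum, pow_add, mul_comm]

lemma stackedHankel_mulVec_eq_zero_iff (A B : Dual F F[X]) (s k : ℕ) (c : Fin k → F) :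
    stackedHankel A B s k *ᵥ c = 0 ↔ ofCoeffs F k c ∈ rightKer A B s k := by
  simp only [mem_rightKer, ofCoeffs_mem, true_and, apply_X_pow_mul_ofCoeffs, forall_and]
  rw [funext_iff, Sum.forall]
  simp [stackedHankel, mulVec, dotProduct, Fin.forall_iff]

lemma rightKer_eq_map (A B : Dual F F[X]) (s k : ℕ) :
    rightKer A B s k =
      (LinearMap.ker (stackedHankel A B s k).mulVecLin).map (ofCoeffs F k) := by
  ext f
  simp only [Submodule.mem_map, LinearMap.mem_ker, mulVecLin_apply,
    stackedHankel_mulVec_eq_zero_iff]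
  constructor
  · intro hf
    obtain ⟨c, rfl⟩ : f ∈ LinearMap.range (ofCoeffs F k) := by
      rw [range_ofCoeffs]; exact hf.1
    exact ⟨c, hf, rfl⟩
  · rintro ⟨c, hc, rfl⟩
    exact hc

lemma finrank_rightKer (A B : Dual F F[X]) (s k : ℕ) :
    finrank F (rightKer A B s k) + (stackedHankel A B s k).rank = k := by
  have h := LinearMap.finrank_range_add_finrank_ker (stackedHankel A B s k).mulVecLin
  rw [Module.finrank_fin_fun] at h
  rw [rightKer_eq_map, Matrix.rank,
    ← (Submodule.equivMapOfInjective _ (ofCoeffs_injective k) _).finrank_eq]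
  omega

/-- The pair of polynomials with prescribed coefficients in degrees `< s`. -/
noncomputable def ofCoeffsPair (F : Type*) [Field F] (s : ℕ) :
    (Fin s ⊕ Fin s → F) →ₗ[F] F[X] × F[X] :=
  ((ofCoeffs F s).prodMap (ofCoeffs F s)) ∘ₗ
    (LinearEquiv.sumArrowLequivProdArrow (Fin s) (Fin s) F F).toLinearMap

lemma ofCoeffsPair_apply (s : ℕ) (c : Fin s ⊕ Fin s → F) :
    ofCoeffsPair F s c = (ofCoeffs F s (c ∘ Sum.inl), ofCoeffs F s (c ∘ Sum.inr)) := rfl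

lemma ofCoeffsPair_injective (s : ℕ) : Function.Injective (ofCoeffsPair F s) :=
  ((ofCoeffs_injective s).prodMap (ofCoeffs_injective s)).comp
    (LinearEquiv.sumArrowLequivProdArrow (Fin s) (Fin s) F F).injective

lemma leftKer_eq_map (A B : Dual F F[X]) (s k : ℕ) :
    leftKer A B s k =
      (LinearMap.ker (stackedHankel A B s k)ᵀ.mulVecLin).map (ofCoeffsPair F s) := by
  have key : ∀ c : Fin s ⊕ Fin s → F, (stackedHankel A B s k)ᵀ *ᵥ c = 0 ↔
      ofCoeffsPair F s c ∈ leftKer A B s k := by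
    intro c
    simp only [mem_leftKer, ofCoeffsPair_apply, ofCoeffs_mem, true_and, apply_X_pow_mul_ofCoeffs]
    rw [funext_iff]
    simp [stackedHankel, mulVec, dotProduct, Fin.forall_iff, add_comm]
  ext z
  simp only [Submodule.mem_map, LinearMap.mem_ker, mulVecLin_apply, key]
  constructor
  · intro hz
    obtain ⟨c, hc⟩ : z.1 ∈ LinearMap.range (ofCoeffs F s) := by
      rw [range_ofCoeffs]; exact hz.1.1
    obtain ⟨d, hd⟩ : z.2 ∈ LinearMap.range (ofCoeffs F s) := by
      rw [range_ofCoeffs]; exact hz.1.2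
    have h : ofCoeffsPair F s (Sum.elim c d) = z := by
      rw [ofCoeffsPair_apply]; ext1 <;> simpa
    exact ⟨_, h ▸ hz, h⟩
  · rintro ⟨c, hc, rfl⟩
    exact hc

lemma finrank_leftKer (A B : Dual F F[X]) (s k : ℕ) :
    finrank F (leftKer A B s k) + (stackedHankel A B s k).rank = 2 * s := by
  have h := LinearMap.finrank_range_add_finrank_ker (stackedHankel A B s k)ᵀ.mulVecLin
  rw [Module.finrank_fintype_fun_eq_card, Fintype.card_sum, Fintype.card_fin] at h
  rw [leftKer_eq_map, ← Matrix.rank_transpose, Matrix.rank,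
    ← (Submodule.equivMapOfInjective _ (ofCoeffsPair_injective s) _).finrank_eq]
  omega

instance (k : ℕ) : FiniteDimensional F (degreeLT F k) :=
  (degreeLTEquiv F k).symm.finiteDimensional

instance (A B : Dual F F[X]) (s k : ℕ) : FiniteDimensional F (rightKer A B s k) :=
  Submodule.finiteDimensional_of_le (S₂ := degreeLT F k) fun _ h => h.1

instance (A B : Dual F F[X]) (s k : ℕ) : FiniteDimensional F (leftKer A B s k) :=
  leftKer_eq_map A B s k ▸ inferInstance

lemma X_mul_mem_degreeLT_succ_s9 {k : ℕ} {f : F[X]} (hf : f ∈ degreeLT F k) :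
    X * f ∈ degreeLT F (k + 1) := by
  rw [mem_degreeLT, degree_lt_iff_coeff_zero] at *
  intro m hm
  obtain ⟨m, rfl⟩ : ∃ n, m = n + 1 := ⟨m - 1, by omega⟩
  rw [coeff_X_mul]
  exact hf m (by omega)

lemma rightKer_le_degreeLT (A B : Dual F F[X]) (s k : ℕ) :
    rightKer A B s k ≤ degreeLT F k := fun _ hf => hf.1

lemma rightKer_le_succ (A B : Dual F F[X]) (t k : ℕ) :
    rightKer A B (t + 1) k ≤ rightKer A B t (k + 1) := fun _ hf =>
  ⟨degreeLT_mono (Nat.le_succ k) hf.1, fun i hi => hf.2 i (by omega)⟩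

lemma X_mul_mem_rightKer {A B : Dual F F[X]} {t k : ℕ} {f : F[X]}
    (hf : f ∈ rightKer A B (t + 1) k) : X * f ∈ rightKer A B t (k + 1) :=
  ⟨X_mul_mem_degreeLT_succ_s9 hf.1, fun i hi => by
    rw [← mul_assoc, ← pow_succ]; exact hf.2 (i + 1) (by omega)⟩

lemma leftKer_succ_le (A B : Dual F F[X]) (t k : ℕ) :
    leftKer A B t (k + 1) ≤ leftKer A B (t + 1) k := fun _ hz =>
  ⟨⟨degreeLT_mono (Nat.le_succ t) hz.1.1, degreeLT_mono (Nat.le_succ t) hz.1.2⟩,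
    fun j hj => hz.2 j (by omega)⟩

lemma X_smul_mem_leftKer {A B : Dual F F[X]} {t k : ℕ} {z : F[X] × F[X]}
    (hz : z ∈ leftKer A B t (k + 1)) : (X : F[X]) • z ∈ leftKer A B (t + 1) k :=
  ⟨⟨X_mul_mem_degreeLT_succ_s9 hz.1.1, X_mul_mem_degreeLT_succ_s9 hz.1.2⟩, fun j hj => by
    have := hz.2 (j + 1) (by omega)
    simpa [pow_succ, mul_assoc] using this⟩

lemma eq_zero_of_forall_X_pow_mul_mem {s : ℕ} {f : F[X]} (h : ∀ n, X ^ n * f ∈ degreeLT F s) :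
    f = 0 := by
  by_contra hf
  have := h s
  rw [mem_degreeLT, degree_mul, degree_X_pow, degree_eq_natDegree hf] at this
  norm_cast at this
  omega

lemma leftKer_eq_bot_of_eq {A B : Dual F F[X]} {t k : ℕ}
    (h : leftKer A B t (k + 1) = leftKer A B (t + 1) k) : leftKer A B (t + 1) k = ⊥ := by
  rw [Submodule.eq_bot_iff]
  intro z hz
  have hpow : ∀ n : ℕ, (X : F[X]) ^ n • z ∈ leftKer A B (t + 1) k := by
    intro n
    induction n with
    | zero => simpa
    | succ n ih =>
      rw [pow_succ', mul_smul]
      exact X_smul_mem_leftKer (h ▸ ih)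
  ext1
  · exact eq_zero_of_forall_X_pow_mul_mem fun n => (hpow n).1.1
  · exact eq_zero_of_forall_X_pow_mul_mem fun n => (hpow n).1.2

/-- Polynomials `P * q` with `q` of degree `< n`. -/
noncomputable def multiplesLT (P : F[X]) (n : ℕ) : Submodule F F[X] :=
  (degreeLT F n).map (LinearMap.mulLeft F P)

lemma mem_multiplesLT {P f : F[X]} {n : ℕ} :
    f ∈ multiplesLT P n ↔ ∃ q ∈ degreeLT F n, P * q = f := Iff.rfl

lemma finrank_degreeLT (n : ℕ) : finrank F (degreeLT F n) = n := by
  rw [(degreeLTEquiv F n).finrank_eq, finrank_fin_fun]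

lemma finrank_multiplesLT {P : F[X]} (hP : P ≠ 0) (n : ℕ) :
    finrank F (multiplesLT P n) = n := by
  have hinj : Function.Injective (LinearMap.mulLeft F P) := fun _ _ h => mul_left_cancel₀ hP h
  rw [multiplesLT, ← (Submodule.equivMapOfInjective _ hinj _).finrank_eq, finrank_degreeLT]

lemma multiplesLT_le {P : F[X]} {n : ℕ} {V : Submodule F F[X]}
    (h : ∀ i < n, X ^ i * P ∈ V) : multiplesLT P n ≤ V := by
  rintro _ ⟨q, hq, rfl⟩
  obtain ⟨c, rfl⟩ : q ∈ LinearMap.range (ofCoeffs F n) := by rwa [range_ofCoeffs]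
  rw [ofCoeffs_apply, map_sum]
  refine sum_mem fun i _ => ?_
  rw [map_smul, LinearMap.mulLeft_apply, mul_comm]
  exact V.smul_mem _ (h i i.2)

lemma exists_natDegree_max {V : Submodule F F[X]} {k : ℕ} (hV : V ≤ degreeLT F k) (hne : V ≠ ⊥) :
    ∃ v ∈ V, v ≠ 0 ∧ ∀ u ∈ V, natDegree u ≤ natDegree v := by
  obtain ⟨w, hw, hw0⟩ := V.ne_bot_iff.mp hne
  have hb : BddAbove (natDegree '' {v | v ∈ V ∧ v ≠ 0}) := by
    refine ⟨k, ?_⟩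
    rintro _ ⟨v, ⟨hv, hv0⟩, rfl⟩
    exact ((natDegree_lt_iff_degree_lt hv0).mpr (mem_degreeLT.mp (hV hv))).le
  have hne' : (natDegree '' {v | v ∈ V ∧ v ≠ 0}).Nonempty := ⟨_, w, ⟨hw, hw0⟩, rfl⟩
  obtain ⟨v, ⟨hv, hv0⟩, hmax⟩ := Nat.sSup_mem hne' hb
  refine ⟨v, hv, hv0, fun u hu => ?_⟩
  rcases eq_or_ne u 0 with rfl | hu0
  · simp
  · rw [hmax]; exact le_csSup hb ⟨u, ⟨hu, hu0⟩, rfl⟩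

lemma exists_natDegree_min {V : Submodule F F[X]} (hne : V ≠ ⊥) :
    ∃ v ∈ V, v ≠ 0 ∧ ∀ u ∈ V, u ≠ 0 → natDegree v ≤ natDegree u := by
  obtain ⟨w, hw, hw0⟩ := V.ne_bot_iff.mp hne
  obtain ⟨v, ⟨hv, hv0⟩, hmin⟩ :=
    Nat.sInf_mem (s := natDegree '' {v | v ∈ V ∧ v ≠ 0}) ⟨_, w, ⟨hw, hw0⟩, rfl⟩
  exact ⟨v, hv, hv0, fun u hu hu0 => hmin ▸ Nat.sInf_le ⟨u, ⟨hu, hu0⟩, rfl⟩⟩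

lemma X_mul_notMem_of_natDegree_max {V : Submodule F F[X]} {v : F[X]} (hv0 : v ≠ 0)
    (hmax : ∀ u ∈ V, natDegree u ≤ natDegree v) : X * v ∉ V := fun h => by
  have := hmax _ h
  rw [natDegree_X_mul hv0] at this
  omega

lemma finrank_lt_finrank_of_X_mul_mem {V W : Submodule F F[X]} [FiniteDimensional F W] {k : ℕ}
    (hV : V ≤ degreeLT F k) (hne : V ≠ ⊥) (hVW : V ≤ W) (hX : ∀ u ∈ V, X * u ∈ W) :
    finrank F V < finrank F W := by
  obtain ⟨v, hv, hv0, hmax⟩ := exists_natDegree_max hV hne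
  refine Submodule.finrank_lt_finrank_of_lt (lt_of_le_of_ne hVW ?_)
  rintro rfl
  exact X_mul_notMem_of_natDegree_max hv0 hmax (hX v hv)

/-- A finite-dimensional space of polynomials whose dimension grows by only one when it is
enlarged by its multiples by `X` consists of the multiples of a single polynomial. -/
lemma exists_eq_multiplesLT {V W : Submodule F F[X]} [FiniteDimensional F W] {k : ℕ}
    (hV : V ≤ degreeLT F k) (hne : V ≠ ⊥) (hVW : V ≤ W) (hX : ∀ u ∈ V, X * u ∈ W)
    (hfin : finrank F W = finrank F V + 1) :
    ∃ P : F[X], P ≠ 0 ∧ V = multiplesLT P (finrank F V) ∧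
      W = multiplesLT P (finrank F V + 1) := by
  have : FiniteDimensional F V := Submodule.finiteDimensional_of_le hVW
  obtain ⟨v, hv, hv0, hmax⟩ := exists_natDegree_max hV hne
  obtain ⟨P, hP, hP0, hmin⟩ := exists_natDegree_min hne
  have hW : V ⊔ Submodule.span F {X * v} = W := by
    have hle : V ⊔ Submodule.span F {X * v} ≤ W :=
      sup_le hVW ((Submodule.span_singleton_le_iff_mem _ _).mpr (hX v hv))
    have : FiniteDimensional F ↥(V ⊔ Submodule.span F {X * v}) :=
      Submodule.finiteDimensional_of_le hle
    refine Submodule.eq_of_le_of_finrank_le hle ?_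
    rw [hfin, Nat.succ_le_iff]
    refine Submodule.finrank_lt_finrank_of_lt (lt_of_le_of_ne le_sup_left fun h => ?_)
    refine X_mul_notMem_of_natDegree_max hv0 hmax ?_
    rw [h]
    exact Submodule.mem_sup_right (Submodule.mem_span_singleton_self _)
  have hclosed : ∀ u ∈ V, natDegree u < natDegree v → X * u ∈ V := by
    intro u hu hlt
    have hm := hX u hu
    rw [← hW] at hm
    obtain ⟨w, hw, y, hy, hwy⟩ := Submodule.mem_sup.mp hm
    obtain ⟨c, rfl⟩ := Submodule.mem_span_singleton.mp hy
    have hcoeff := congrArg (fun f => coeff f (natDegree v + 1)) hwy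
    have hw1 := hmax w hw
    simp only [coeff_add, coeff_smul, coeff_X_mul, smul_eq_mul,
      coeff_eq_zero_of_natDegree_lt hlt,
      coeff_eq_zero_of_natDegree_lt (show natDegree w < natDegree v + 1 by omega), zero_add] at hcoeff
    have hc : c = 0 := by
      rcases mul_eq_zero.mp hcoeff with h | h
      · exact h
      · exact absurd (leadingCoeff_eq_zero.mp h) hv0
    rw [← hwy, hc]
    simpa using hw
  have hPv := hmin v hv hv0
  have hpow : ∀ i < natDegree v - natDegree P + 1, X ^ i * P ∈ V := by
    intro i
    induction i with
    | zero => intro _; simpa using hP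
    | succ i ih =>
      intro hi
      rw [pow_succ', mul_assoc]
      refine hclosed _ (ih (by omega)) ?_
      rw [natDegree_X_pow_mul i hP0]
      omega
  have hle := multiplesLT_le hpow
  have hVeq : V = multiplesLT P (natDegree v - natDegree P + 1) := by
    refine le_antisymm (fun u hu => ?_) hle
    rcases eq_or_ne u 0 with rfl | hu0
    · exact zero_mem _
    have hq : u / P ∈ degreeLT F (natDegree v - natDegree P + 1) := by
      have hdeg : degree P + degree (u / P) = degree u := degree_add_div hP0
        (by simpa [degree_eq_natDegree hP0, degree_eq_natDegree hu0] using hmin u hu hu0)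
      rw [mem_degreeLT]
      rcases eq_or_ne (u / P) 0 with h0 | h0
      · rw [h0, degree_zero]; exact WithBot.bot_lt_coe _
      rw [degree_eq_natDegree h0, degree_eq_natDegree hP0, degree_eq_natDegree hu0] at hdeg
      rw [degree_eq_natDegree h0]
      norm_cast at hdeg ⊢
      have := hmax u hu
      omega
    have hmem : P * (u / P) ∈ multiplesLT P (natDegree v - natDegree P + 1) := ⟨_, hq, rfl⟩
    have hmod : u % P ∈ V := by
      rw [EuclideanDomain.mod_eq_sub_mul_div]
      exact sub_mem hu (hle hmem)
    have hmod0 : u % P = 0 := by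
      by_contra h
      have h1 := hmin _ hmod h
      have h2 := natDegree_lt_natDegree h (degree_mod_lt u hP0)
      omega
    rw [← EuclideanDomain.div_add_mod u P, hmod0, add_zero]
    exact hmem
  have hn : finrank F V = natDegree v - natDegree P + 1 := by
    conv_lhs => rw [hVeq]
    exact finrank_multiplesLT hP0 _
  refine ⟨P, hP0, by rw [hn]; exact hVeq, ?_⟩
  symm
  refine Submodule.eq_of_le_of_finrank_le (multiplesLT_le fun i hi => ?_) ?_
  · rcases Nat.lt_succ_iff_lt_or_eq.mp hi with hi | rfl
    · exact hVW (hpow i (hn ▸ hi))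
    · rw [hn, pow_succ', mul_assoc]
      exact hX _ (hpow _ (by omega))
  · rw [hfin, finrank_multiplesLT hP0]

/-- The functional on `F[X]` with prescribed moments in degrees `< N` and zero moments beyond. -/
noncomputable def momentFunctional (F : Type*) [Field F] (N : ℕ) :
    (Fin N → F) →ₗ[F] Dual F F[X] :=
  ∑ n : Fin N, (LinearMap.proj n).smulRight (lcoeff F n)

lemma momentFunctional_apply {N : ℕ} (α : Fin N → F) (f : F[X]) :
    momentFunctional F N α f = ∑ n, α n * coeff f n := by
  simp [momentFunctional]

lemma momentFunctional_X_pow {N : ℕ} (α : Fin N → F) (n : Fin N) :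
    momentFunctional F N α (X ^ (n : ℕ)) = α n := by
  simp [momentFunctional_apply, coeff_X_pow, Fin.val_inj]

lemma momentFunctional_ofCoeffs {N : ℕ} (α c : Fin N → F) :
    momentFunctional F N α (ofCoeffs F N c) = ∑ n, α n * c n := by
  simp [ofCoeffs_apply, momentFunctional_X_pow, mul_comm]

/-- Contraction of a sequence by `Q`, i.e. the action of `Q` evaluated at the shift operator. -/
noncomputable def contract (N m : ℕ) (Q : F[X]) : (Fin (N + m) → F) →ₗ[F] (Fin N → F) :=
  LinearMap.pi fun i => Dual.eval F F[X] (X ^ (i : ℕ) * Q) ∘ₗ momentFunctional F (N + m)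

lemma contract_apply (N m : ℕ) (Q : F[X]) (α : Fin (N + m) → F) (i : Fin N) :
    contract N m Q α i = momentFunctional F (N + m) α (X ^ (i : ℕ) * Q) := rfl

lemma momentFunctional_contract {N m : ℕ} (Q : F[X]) (α : Fin (N + m) → F) {f : F[X]}
    (hf : f ∈ degreeLT F N) :
    momentFunctional F N (contract N m Q α) f = momentFunctional F (N + m) α (Q * f) := by
  obtain ⟨c, rfl⟩ : f ∈ LinearMap.range (ofCoeffs F N) := by rwa [range_ofCoeffs]
  rw [momentFunctional_ofCoeffs, ofCoeffs_apply, Finset.mul_sum, map_sum]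
  refine Finset.sum_congr rfl fun i _ => ?_
  rw [contract_apply, mul_smul_comm, map_smul, smul_eq_mul, mul_comm, mul_comm Q]

lemma mul_mem_degreeLT_iff {Q f : F[X]} (hQ : Q ≠ 0) (k : ℕ) :
    Q * f ∈ degreeLT F (k + natDegree Q) ↔ f ∈ degreeLT F k := by
  rcases eq_or_ne f 0 with rfl | hf
  · simp
  rw [mem_degreeLT, mem_degreeLT, ← natDegree_lt_iff_degree_lt hf,
    ← natDegree_lt_iff_degree_lt (mul_ne_zero hQ hf), natDegree_mul hQ hf]
  omega

lemma mul_mem_degreeLT {P q : F[X]} {n k : ℕ} (hq : q ∈ degreeLT F n)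
    (h : natDegree P + n ≤ k) : P * q ∈ degreeLT F k := by
  rcases eq_or_ne P 0 with rfl | hP
  · simp
  exact degreeLT_mono (by omega) ((mul_mem_degreeLT_iff hP n).mpr hq)

lemma X_pow_mul_mem_degreeLT_s9 {q : F[X]} {n k i : ℕ} (hq : q ∈ degreeLT F n) (h : i + n ≤ k) :
    X ^ i * q ∈ degreeLT F k :=
  mul_mem_degreeLT hq (by rwa [natDegree_X_pow])

lemma X_pow_mem_degreeLT {i n : ℕ} (h : i < n) : (X : F[X]) ^ i ∈ degreeLT F n := by
  rw [mem_degreeLT, degree_X_pow]; exact_mod_cast h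

lemma natDegree_add_le_of_multiplesLT_le {P : F[X]} (hP : P ≠ 0) {n k : ℕ} (hn : 0 < n)
    (h : multiplesLT P n ≤ degreeLT F k) : natDegree P + n ≤ k := by
  have hmem : P * X ^ (n - 1) ∈ degreeLT F k := h ⟨_, X_pow_mem_degreeLT (by omega), rfl⟩
  have hne : P * X ^ (n - 1) ≠ 0 := mul_ne_zero hP (pow_ne_zero _ X_ne_zero)
  rw [mem_degreeLT, ← natDegree_lt_iff_degree_lt hne, natDegree_mul_X_pow _ hP] at hmem
  omega

lemma mem_rightKer_contract_iff {N s k : ℕ} {Q : F[X]} (hQ : Q ≠ 0) (hN : s + k ≤ N + 1)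
    (α β : Fin (N + natDegree Q) → F) (f : F[X]) :
    f ∈ rightKer (momentFunctional F N (contract N _ Q α))
        (momentFunctional F N (contract N _ Q β)) s k ↔
      Q * f ∈ rightKer (momentFunctional F _ α) (momentFunctional F _ β) s (k + natDegree Q) := by
  rw [mem_rightKer, mem_rightKer, mul_mem_degreeLT_iff hQ]
  refine and_congr_right fun hf => forall₂_congr fun i hi => ?_
  rw [momentFunctional_contract Q α (X_pow_mul_mem_degreeLT_s9 hf (by omega)),
    momentFunctional_contract Q β (X_pow_mul_mem_degreeLT_s9 hf (by omega)), mul_left_comm]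

lemma rightKer_contract_eq {N s k n : ℕ} {P Q : F[X]} (hQ : Q ≠ 0) (hPQ : IsCoprime Q P)
    (hN : s + k ≤ N + 1) {α β : Fin (N + natDegree Q) → F}
    (h : rightKer (momentFunctional F _ α) (momentFunctional F _ β) s (k + natDegree Q) =
      multiplesLT P (n + natDegree Q)) :
    rightKer (momentFunctional F N (contract N _ Q α))
      (momentFunctional F N (contract N _ Q β)) s k = multiplesLT P n := by
  ext f
  rw [mem_rightKer_contract_iff hQ hN, h, mem_multiplesLT, mem_multiplesLT]
  constructor
  · rintro ⟨q, hq, hqf⟩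
    obtain ⟨r, rfl⟩ := hPQ.dvd_of_dvd_mul_left (Dvd.intro f hqf.symm)
    refine ⟨r, (mul_mem_degreeLT_iff hQ n).mp hq, mul_left_cancel₀ hQ ?_⟩
    rw [← hqf]; ring
  · rintro ⟨r, hr, rfl⟩
    exact ⟨Q * r, (mul_mem_degreeLT_iff hQ n).mpr hr, by ring⟩

lemma IsCoprime.exists_degreeLT_decomposition {P Q : F[X]} (hQ : Q ≠ 0) (hPQ : IsCoprime Q P)
    (f : F[X]) : ∃ a ∈ degreeLT F (natDegree Q), ∃ b, P * a + Q * b = f := by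
  obtain ⟨u, v, huv⟩ := hPQ
  refine ⟨(v * f) % Q, ?_, u * f + P * (v * f / Q), ?_⟩
  · rw [mem_degreeLT, ← degree_eq_natDegree hQ]
    exact degree_mod_lt _ hQ
  · have := EuclideanDomain.div_add_mod (v * f) Q
    linear_combination P * this + f * huv

/-- Sequences of length `N` annihilated by `P * q` for all `q` of degree `< e`. -/
noncomputable def annihilatedSeq (N : ℕ) (P : F[X]) (e : ℕ) : Submodule F (Fin N → F) :=
  LinearMap.ker (LinearMap.pi fun i : Fin e =>
    Dual.eval F F[X] (X ^ (i : ℕ) * P) ∘ₗ momentFunctional F N)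

lemma mem_annihilatedSeq {N e : ℕ} {P : F[X]} {α : Fin N → F} :
    α ∈ annihilatedSeq N P e ↔ ∀ i < e, momentFunctional F N α (X ^ i * P) = 0 := by
  rw [annihilatedSeq, LinearMap.mem_ker, funext_iff, Fin.forall_iff]
  rfl

lemma momentFunctional_mul_eq_zero {N e : ℕ} {P : F[X]} {α : Fin N → F}
    (hα : α ∈ annihilatedSeq N P e) {q : F[X]} (hq : q ∈ degreeLT F e) :
    momentFunctional F N α (P * q) = 0 :=
  multiplesLT_le (V := LinearMap.ker (momentFunctional F N α)) (mem_annihilatedSeq.mp hα)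
    ⟨q, hq, rfl⟩

lemma finrank_annihilatedSeq {N e : ℕ} {P : F[X]} (hP : P ≠ 0) (h : natDegree P + e ≤ N) :
    finrank F (annihilatedSeq N P e) + e = N := by
  set T : (Fin N → F) →ₗ[F] (Fin e → F) := LinearMap.pi fun i : Fin e =>
    Dual.eval F F[X] (X ^ (i : ℕ) * P) ∘ₗ momentFunctional F N with hT
  have hTapp : ∀ α i, T α i = momentFunctional F N α (X ^ (i : ℕ) * P) := fun _ _ => rfl
  have hsurj : Function.Surjective T := by
    rw [← LinearMap.dualMap_injective_iff, ← LinearMap.ker_eq_bot, LinearMap.ker_eq_bot']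
    intro φ hφ
    set c : Fin e → F := fun i => φ (Pi.single i 1) with hc
    have hφc : ∀ x, φ x = ∑ i, x i * c i := by
      intro x
      conv_lhs => rw [pi_eq_sum_univ' x]
      simp [hc, Pi.single]
    have hzero : ∀ α, momentFunctional F N α (P * ofCoeffs F e c) = 0 := by
      intro α
      have h0 : φ (T α) = 0 := LinearMap.congr_fun hφ α
      rw [hφc] at h0
      rw [ofCoeffs_apply, Finset.mul_sum, map_sum, ← h0]
      refine Finset.sum_congr rfl fun i _ => ?_
      rw [hTapp, mul_smul_comm, map_smul, smul_eq_mul, mul_comm P, mul_comm]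
    have hmem := mul_mem_degreeLT (ofCoeffs_mem e c) h
    have hprod : P * ofCoeffs F e c = 0 := by
      obtain ⟨d, hd⟩ : P * ofCoeffs F e c ∈ LinearMap.range (ofCoeffs F N) := by
        rwa [range_ofCoeffs]
      have : d = 0 := by
        ext j
        have := hzero (Pi.single j 1)
        rw [← hd, momentFunctional_ofCoeffs] at this
        simpa [Pi.single_apply] using this
      rw [← hd, this, map_zero]
    have hc0 : c = 0 := by
      refine ofCoeffs_injective e ?_
      rw [map_zero]
      exact (mul_eq_zero.mp hprod).resolve_left hP
    ext x
    simp [hφc, hc0]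
  have hr := LinearMap.finrank_range_add_finrank_ker T
  rw [LinearMap.range_eq_top.mpr hsurj, finrank_top, finrank_fin_fun, finrank_fin_fun] at hr
  rw [annihilatedSeq, ← hT]
  omega

lemma mem_annihilatedSeq_of_rightKer {N t k n : ℕ} {P : F[X]} {α β : Fin N → F} (hn : 0 < n)
    (h : rightKer (momentFunctional F N α) (momentFunctional F N β) (t + 1) k =
      multiplesLT P n) :
    α ∈ annihilatedSeq N P (n + t) ∧ β ∈ annihilatedSeq N P (n + t) := by
  rw [mem_annihilatedSeq, mem_annihilatedSeq, ← forall₂_and]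
  intro j hj
  obtain ⟨i, l, hi, hl, rfl⟩ : ∃ i l, i < t + 1 ∧ l < n ∧ j = i + l :=
    ⟨min j t, j - min j t, by omega, by omega, by omega⟩
  have hmem : P * X ^ l ∈ multiplesLT P n := ⟨_, X_pow_mem_degreeLT hl, rfl⟩
  rw [← h] at hmem
  rw [pow_add, mul_assoc, mul_comm (X ^ l)]
  exact hmem.2 i hi

lemma eq_zero_of_contract_eq_zero {N e : ℕ} {P Q : F[X]} (hQ : Q ≠ 0) (hPQ : IsCoprime Q P)
    (hP : natDegree P ≤ N) (he : natDegree Q ≤ e) {δ : Fin (N + natDegree Q) → F}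
    (hδ : δ ∈ annihilatedSeq _ P e) (h : contract N _ Q δ = 0) : δ = 0 := by
  ext j
  rw [← momentFunctional_X_pow δ j]
  obtain ⟨a, ha, b, hab⟩ := hPQ.exists_degreeLT_decomposition hQ (X ^ (j : ℕ))
  have hb : b ∈ degreeLT F N := by
    rw [← mul_mem_degreeLT_iff hQ, ← add_sub_cancel_left (P * a) (Q * b), hab]
    exact sub_mem (X_pow_mem_degreeLT j.2) (mul_mem_degreeLT ha (by omega))
  rw [← hab, map_add, momentFunctional_mul_eq_zero hδ (degreeLT_mono he ha),
    ← momentFunctional_contract Q δ hb, h]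
  simp

lemma contract_mem_annihilatedSeq {N e : ℕ} {P Q : F[X]} (hP : natDegree P + e ≤ N)
    {α : Fin (N + natDegree Q) → F} (hα : α ∈ annihilatedSeq _ P (e + natDegree Q)) :
    contract N _ Q α ∈ annihilatedSeq N P e := by
  rw [mem_annihilatedSeq]
  intro i hi
  have hX : (X : F[X]) ^ i ∈ degreeLT F e := X_pow_mem_degreeLT hi
  rw [mul_comm, momentFunctional_contract Q α (mul_mem_degreeLT hX hP), mul_left_comm]
  exact momentFunctional_mul_eq_zero hα (mul_mem_degreeLT hX (by omega))

lemma exists_contract_eq {N e : ℕ} {P Q : F[X]} (hP0 : P ≠ 0) (hQ : Q ≠ 0)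
    (hPQ : IsCoprime Q P) (hP : natDegree P + e ≤ N) {α : Fin N → F}
    (hα : α ∈ annihilatedSeq N P e) :
    ∃ α' ∈ annihilatedSeq (N + natDegree Q) P (e + natDegree Q), contract N _ Q α' = α := by
  set C := (contract N (natDegree Q) Q).restrict
    (p := annihilatedSeq (N + natDegree Q) P (e + natDegree Q)) (q := annihilatedSeq N P e)
    (fun _ h => contract_mem_annihilatedSeq hP h) with hC
  have hinj : Function.Injective C := by
    rw [← LinearMap.ker_eq_bot, LinearMap.ker_eq_bot']
    intro x hx
    ext1
    exact eq_zero_of_contract_eq_zero hQ hPQ (by omega) (by omega) x.2 (congrArg Subtype.val hx)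
  have h1 := finrank_annihilatedSeq hP0 hP
  have h2 := finrank_annihilatedSeq (N := N + natDegree Q) (e := e + natDegree Q) hP0 (by omega)
  obtain ⟨x, hx⟩ := (LinearMap.injective_iff_surjective_of_finrank_eq_finrank
    (f := C) (by omega)).mp hinj ⟨α, hα⟩
  exact ⟨x, x.2, congrArg Subtype.val hx⟩

lemma rightKer_eq_of_contract {N s k n e : ℕ} {P Q : F[X]} (hP0 : P ≠ 0) (hQ : Q ≠ 0)
    (hPQ : IsCoprime Q P) (hN : s + k ≤ N + 1) (hn : 0 < n) (he : n + s ≤ e + 1)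
    {α β : Fin (N + natDegree Q) → F}
    (hα : α ∈ annihilatedSeq _ P (e + natDegree Q))
    (hβ : β ∈ annihilatedSeq _ P (e + natDegree Q))
    (h : rightKer (momentFunctional F N (contract N _ Q α))
      (momentFunctional F N (contract N _ Q β)) s k = multiplesLT P n) :
    rightKer (momentFunctional F _ α) (momentFunctional F _ β) s (k + natDegree Q) =
      multiplesLT P (n + natDegree Q) := by
  have hPk : natDegree P + n ≤ k := natDegree_add_le_of_multiplesLT_le hP0 hn
    (h.symm.le.trans (rightKer_le_degreeLT _ _ _ _))
  have hge : multiplesLT P (n + natDegree Q) ≤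
      rightKer (momentFunctional F _ α) (momentFunctional F _ β) s (k + natDegree Q) := by
    rintro _ ⟨q, hq, rfl⟩
    refine ⟨mul_mem_degreeLT hq (by omega), fun i hi => ?_⟩
    rw [LinearMap.mulLeft_apply, mul_left_comm]
    have hX := X_pow_mul_mem_degreeLT_s9 hq (show i + (n + natDegree Q) ≤ e + natDegree Q by omega)
    exact ⟨momentFunctional_mul_eq_zero hα hX, momentFunctional_mul_eq_zero hβ hX⟩
  refine le_antisymm (fun f hf => ?_) hge
  obtain ⟨a, ha, b, rfl⟩ := hPQ.exists_degreeLT_decomposition hQ f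
  have hPa : P * a ∈ multiplesLT P (n + natDegree Q) :=
    ⟨a, degreeLT_mono (by omega) ha, rfl⟩
  have hQb := sub_mem hf (hge hPa)
  rw [add_sub_cancel_left, ← mem_rightKer_contract_iff hQ hN, h] at hQb
  obtain ⟨q, hq, rfl⟩ := hQb
  refine add_mem hPa ⟨Q * q, (mul_mem_degreeLT_iff hQ n).mpr hq, ?_⟩
  simp only [LinearMap.mulLeft_apply]
  ring

/-- The rank of the stacked Hankel matrix of a pair of sequences of length `N`. -/
noncomputable def pairRank (N s k : ℕ) (ω : (Fin N → F) × (Fin N → F)) : ℕ :=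
  (stackedHankel (momentFunctional F N ω.1) (momentFunctional F N ω.2) s k).rank

variable {N t k : ℕ} (ω : (Fin N → F) × (Fin N → F))

/-- The right kernel of the stacked Hankel matrix of a pair of sequences of length `N`. -/
noncomputable abbrev pairKer (N s k : ℕ) (ω : (Fin N → F) × (Fin N → F)) : Submodule F F[X] :=
  rightKer (momentFunctional F N ω.1) (momentFunctional F N ω.2) s k

lemma finrank_pairKer (s : ℕ) : finrank F (pairKer N s k ω) + pairRank N s k ω = k :=
  finrank_rightKer _ _ s k

lemma pairRank_le (s : ℕ) : pairRank N s k ω ≤ 2 * s := by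
  have := finrank_leftKer (momentFunctional F N ω.1) (momentFunctional F N ω.2) s k
  unfold pairRank
  omega

lemma pairRank_succ_le_add_two : pairRank N (t + 1) k ω ≤ pairRank N t (k + 1) ω + 2 := by
  have h1 := finrank_leftKer (momentFunctional F N ω.1) (momentFunctional F N ω.2) (t + 1) k
  have h2 := finrank_leftKer (momentFunctional F N ω.1) (momentFunctional F N ω.2) t (k + 1)
  have h3 := Submodule.finrank_mono
    (leftKer_succ_le (momentFunctional F N ω.1) (momentFunctional F N ω.2) t k)
  unfold pairRank
  omega

lemma pairRank_succ_eq_of_eq_add_two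
    (h : pairRank N (t + 1) k ω = pairRank N t (k + 1) ω + 2) :
    pairRank N (t + 1) k ω = 2 * (t + 1) := by
  have h1 := finrank_leftKer (momentFunctional F N ω.1) (momentFunctional F N ω.2) (t + 1) k
  have h2 := finrank_leftKer (momentFunctional F N ω.1) (momentFunctional F N ω.2) t (k + 1)
  have h3 := Submodule.eq_of_le_of_finrank_eq
    (leftKer_succ_le (momentFunctional F N ω.1) (momentFunctional F N ω.2) t k)
    (by unfold pairRank at h; omega)
  rw [leftKer_eq_bot_of_eq h3, finrank_bot] at h1
  unfold pairRank
  omega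

lemma pairRank_le_pairRank_succ (hk : 2 * t + 1 ≤ k) :
    pairRank N t (k + 1) ω ≤ pairRank N (t + 1) k ω := by
  have h0 := finrank_pairKer (k := k) ω (t + 1)
  have h1 := finrank_pairKer (k := k + 1) ω t
  have h2 := pairRank_le (k := k + 1) ω t
  rcases eq_or_ne (pairKer N (t + 1) k ω) ⊥ with hbot | hne
  · rw [hbot, finrank_bot] at h0
    omega
  · have := finrank_lt_finrank_of_X_mul_mem
      (V := pairKer N (t + 1) k ω) (W := pairKer N t (k + 1) ω) (rightKer_le_degreeLT _ _ _ _) hne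
      (rightKer_le_succ (momentFunctional F N ω.1) (momentFunctional F N ω.2) t k)
      fun _ => X_mul_mem_rightKer
    omega

variable {ω}

lemma exists_pairKer_eq_multiplesLT (hk : 2 * t + 1 ≤ k)
    (h : pairRank N (t + 1) k ω = pairRank N t (k + 1) ω) :
    ∃ (P : F[X]) (n : ℕ), P ≠ 0 ∧ 0 < n ∧ n + pairRank N (t + 1) k ω = k ∧
      natDegree P ≤ 2 * t ∧ natDegree P + n ≤ k ∧
      pairKer N (t + 1) k ω = multiplesLT P n ∧
      pairKer N t (k + 1) ω = multiplesLT P (n + 1) := by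
  have h0 := finrank_pairKer (k := k) ω (t + 1)
  have h1 := finrank_pairKer (k := k + 1) ω t
  have h2 := pairRank_le (k := k + 1) ω t
  have hne : pairKer N (t + 1) k ω ≠ ⊥ := by
    intro hbot
    rw [hbot, finrank_bot] at h0
    omega
  obtain ⟨P, hP, hV, hW⟩ := exists_eq_multiplesLT
    (V := pairKer N (t + 1) k ω) (W := pairKer N t (k + 1) ω)
    (rightKer_le_degreeLT _ _ _ _) hne
    (rightKer_le_succ (momentFunctional F N ω.1) (momentFunctional F N ω.2) t k)
    (fun _ => X_mul_mem_rightKer) (by omega)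
  have hn : 0 < finrank F (pairKer N (t + 1) k ω) := by omega
  have hdeg := natDegree_add_le_of_multiplesLT_le hP hn
    (hV.symm.le.trans (rightKer_le_degreeLT _ _ _ _))
  exact ⟨P, _, hP, hn, h0, by omega, hdeg, hV, hW⟩

lemma pairRank_of_eq_multiplesLT {s n : ℕ} {P : F[X]} (hP : P ≠ 0)
    (h : pairKer N s k ω = multiplesLT P n) : n + pairRank N s k ω = k := by
  have := finrank_pairKer (k := k) ω s
  rwa [h, finrank_multiplesLT hP] at this

lemma pairKer_contract_eq {Q : F[X]} (hk : 2 * t + 1 ≤ k) (hN : N = t + k) (hQ : Q ≠ 0)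
    (hQP : ∀ P : F[X], P ≠ 0 → natDegree P ≤ 2 * t → IsCoprime Q P)
    {ω : (Fin (N + natDegree Q) → F) × (Fin (N + natDegree Q) → F)}
    (h : pairRank _ (t + 1) (k + natDegree Q) ω = pairRank _ t (k + natDegree Q + 1) ω) :
    ∃ (P : F[X]) (n : ℕ), P ≠ 0 ∧ 0 < n ∧ natDegree P ≤ 2 * t ∧
      pairKer _ (t + 1) (k + natDegree Q) ω = multiplesLT P (n + natDegree Q) ∧
      pairKer N (t + 1) k (ω.map (contract N _ Q) (contract N _ Q)) = multiplesLT P n ∧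
      pairKer N t (k + 1) (ω.map (contract N _ Q) (contract N _ Q)) = multiplesLT P (n + 1) := by
  obtain ⟨P, n', hP, hn', hrank, hdeg, -, hV, hW⟩ :=
    exists_pairKer_eq_multiplesLT (by omega) h
  have hle := pairRank_le (k := k + natDegree Q + 1) ω t
  obtain ⟨n, rfl⟩ : ∃ n, n' = n + natDegree Q := ⟨n' - natDegree Q, by omega⟩
  refine ⟨P, n, hP, by omega, hdeg, hV, rightKer_contract_eq hQ (hQP P hP hdeg) (by omega) hV,
    rightKer_contract_eq hQ (hQP P hP hdeg) (by omega) ?_⟩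
  rw [add_right_comm k, add_right_comm n]
  exact hW

lemma exists_pairRank_contract {Q : F[X]} (hk : 2 * t + 1 ≤ k) (hN : N = t + k) (hQ : Q ≠ 0)
    (hQP : ∀ P : F[X], P ≠ 0 → natDegree P ≤ 2 * t → IsCoprime Q P)
    (h : pairRank N (t + 1) k ω = pairRank N t (k + 1) ω) :
    ∃ ω' : (Fin (N + natDegree Q) → F) × (Fin (N + natDegree Q) → F),
      pairRank _ (t + 1) (k + natDegree Q) ω' = pairRank _ t (k + natDegree Q + 1) ω' ∧
      ω'.map (contract N _ Q) (contract N _ Q) = ω := by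
  obtain ⟨P, n, hP, hn, -, hdeg, hPk, hV, hW⟩ := exists_pairKer_eq_multiplesLT hk h
  obtain ⟨hα, hβ⟩ := mem_annihilatedSeq_of_rightKer hn hV
  have hQP := hQP P hP hdeg
  obtain ⟨α', hα', hCα⟩ := exists_contract_eq hP hQ hQP (by omega) hα
  obtain ⟨β', hβ', hCβ⟩ := exists_contract_eq hP hQ hQP (by omega) hβ
  have h1 := rightKer_eq_of_contract (s := t + 1) (k := k) hP hQ hQP (by omega) hn (by omega)
    hα' hβ' (by rwa [hCα, hCβ])
  have h2 := rightKer_eq_of_contract (s := t) (k := k + 1) hP hQ hQP (by omega) n.succ_pos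
    (by omega) hα' hβ' (by rwa [hCα, hCβ])
  have r1 := pairRank_of_eq_multiplesLT (ω := (α', β')) hP h1
  have r2 := pairRank_of_eq_multiplesLT (ω := (α', β')) hP h2
  refine ⟨(α', β'), ?_, Prod.ext hCα hCβ⟩
  rw [add_right_comm k]
  omega

lemma contract_injOn {Q : F[X]} (hk : 2 * t + 1 ≤ k) (hN : N = t + k) (hQ : Q ≠ 0)
    (hQP : ∀ P : F[X], P ≠ 0 → natDegree P ≤ 2 * t → IsCoprime Q P)
    {ω ω' : (Fin (N + natDegree Q) → F) × (Fin (N + natDegree Q) → F)}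
    (h : pairRank _ (t + 1) (k + natDegree Q) ω = pairRank _ t (k + natDegree Q + 1) ω)
    (h' : pairRank _ (t + 1) (k + natDegree Q) ω' = pairRank _ t (k + natDegree Q + 1) ω')
    (heq : ω.map (contract N _ Q) (contract N _ Q) = ω'.map (contract N _ Q) (contract N _ Q)) :
    ω = ω' := by
  obtain ⟨P, n, hP, hn, hdeg, hV, hV1, -⟩ := pairKer_contract_eq hk hN hQ hQP h
  obtain ⟨P', n', hP', hn', hdeg', hV', hV1', -⟩ := pairKer_contract_eq hk hN hQ hQP h'
  have hmul : multiplesLT P n = multiplesLT P' n' := by rw [← hV1, ← hV1', heq]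
  have hnn : n = n' := by
    have := congrArg (fun V : Submodule F F[X] => finrank F V) hmul
    simpa [finrank_multiplesLT hP, finrank_multiplesLT hP'] using this
  subst hnn
  have hone : (1 : F[X]) ∈ degreeLT F n := by simpa using X_pow_mem_degreeLT hn
  have hker : multiplesLT P (n + natDegree Q) = multiplesLT P' (n + natDegree Q) := by
    obtain ⟨q, hq, hqP⟩ : P ∈ multiplesLT P' n := hmul ▸ ⟨1, hone, mul_one _⟩
    obtain ⟨q', hq', hqP'⟩ : P' ∈ multiplesLT P n :=
      hmul.symm ▸ ⟨1, hone, mul_one _⟩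
    simp only [LinearMap.mulLeft_apply] at hqP hqP'
    have hunit : q * q' = 1 := by
      refine mul_left_cancel₀ hP' ?_
      rw [← mul_assoc, hqP, hqP', mul_one]
    have hq0 : natDegree q = 0 := natDegree_eq_zero_of_isUnit (IsUnit.of_mul_eq_one _ hunit)
    have hq0' : natDegree q' = 0 :=
      natDegree_eq_zero_of_isUnit (IsUnit.of_mul_eq_one _ ((mul_comm _ _).trans hunit))
    refine le_antisymm ?_ ?_
    · rintro _ ⟨r, hr, rfl⟩
      exact ⟨q * r, mul_mem_degreeLT hr (by omega), by simp [← hqP]⟩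
    · rintro _ ⟨r, hr, rfl⟩
      exact ⟨q' * r, mul_mem_degreeLT hr (by omega), by simp [← hqP']⟩
  have hA := mem_annihilatedSeq_of_rightKer (by omega) hV
  have hA' := mem_annihilatedSeq_of_rightKer (by omega) (hV'.trans hker.symm)
  have hzero : ∀ δ, δ ∈ annihilatedSeq _ P (n + natDegree Q + t) → contract N _ Q δ = 0 → δ = 0 :=
    fun δ => eq_zero_of_contract_eq_zero hQ (hQP P hP hdeg) (by omega) (by omega)
  ext1
  · refine sub_eq_zero.mp (hzero _ (sub_mem hA.1 hA'.1) ?_)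
    rw [map_sub, sub_eq_zero]; exact congrArg Prod.fst heq
  · refine sub_eq_zero.mp (hzero _ (sub_mem hA.2 hA'.2) ?_)
    rw [map_sub, sub_eq_zero]; exact congrArg Prod.snd heq

variable (F) in
/-- Polynomials of any large degree without nonconstant factors of degree at most `D`. -/
lemma exists_isCoprime_of_natDegree_le [Finite F] (D : ℕ) : ∃ m₀, ∀ m ≥ m₀, ∃ Q : F[X],
    Q ≠ 0 ∧ natDegree Q = m ∧ ∀ P : F[X], P ≠ 0 → natDegree P ≤ D → IsCoprime Q P := by
  classical
  have := Fintype.ofFinite F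
  set R : F[X] := ∏ c ∈ Finset.univ.filter (fun c : Fin (D + 1) → F => c ≠ 0),
    ofCoeffs F (D + 1) c with hR
  have hR0 : R ≠ 0 := by
    rw [hR, Finset.prod_ne_zero_iff]
    intro c hc
    rw [Finset.mem_filter] at hc
    exact (map_ne_zero_iff _ (ofCoeffs_injective (D + 1))).mpr hc.2
  refine ⟨natDegree R + 1, fun m hm => ?_⟩
  have hdeg : natDegree (X ^ (m - natDegree R) * R) = m := by
    rw [natDegree_X_pow_mul _ hR0]; omega
  have hdeg1 : natDegree (X ^ (m - natDegree R) * R + 1) = m := by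
    rw [← C_1, natDegree_add_C, hdeg]
  refine ⟨X ^ (m - natDegree R) * R + 1, ?_, hdeg1, fun P hP hPD => ?_⟩
  · intro h0
    rw [h0, natDegree_zero] at hdeg1
    omega
  · have hPR : P ∣ R := by
      obtain ⟨c, rfl⟩ : P ∈ LinearMap.range (ofCoeffs F (D + 1)) := by
        rw [range_ofCoeffs, mem_degreeLT, ← natDegree_lt_iff_degree_lt hP]; omega
      refine Finset.dvd_prod_of_mem _ (Finset.mem_filter.mpr ⟨Finset.mem_univ _, ?_⟩)
      rintro rfl
      exact hP (map_zero _)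
    obtain ⟨r, hr⟩ := hPR
    exact ⟨1, -(X ^ (m - natDegree R) * r), by rw [hr]; ring⟩

end PolynomialKernels

section GammaCount

open Polynomial Module

lemma sum_two_pow_finrank_pairKer {N a k : ℕ} (h : a + k = N + 1) :
    ∑ ω : (Fin N → ZMod 2) × (Fin N → ZMod 2), 2 ^ finrank (ZMod 2) (pairKer N a k ω) =
      2 ^ (2 * N) + (2 ^ k - 1) * 2 ^ (2 * (N - a)) := by
  classical
  have hcard : ∀ ω : (Fin N → ZMod 2) × (Fin N → ZMod 2),
      2 ^ finrank (ZMod 2) (pairKer N a k ω) =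
        ∑ c : Fin k → ZMod 2, if ofCoeffs (ZMod 2) k c ∈ pairKer N a k ω then 1 else 0 := by
    intro ω
    rw [Finset.sum_boole, ← Fintype.card_subtype, ← Nat.card_eq_fintype_card]
    have hcomap : finrank (ZMod 2) (pairKer N a k ω) =
        finrank (ZMod 2) ((pairKer N a k ω).comap (ofCoeffs (ZMod 2) k)) := by
      have hmap : ((pairKer N a k ω).comap (ofCoeffs (ZMod 2) k)).map (ofCoeffs (ZMod 2) k) =
          pairKer N a k ω := by
        rw [Submodule.map_comap_eq, range_ofCoeffs, inf_eq_right]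
        exact rightKer_le_degreeLT _ _ _ _
      conv_lhs => rw [← hmap]
      exact (Submodule.equivMapOfInjective _ (ofCoeffs_injective k) _).finrank_eq.symm
    have := natCard_eq_pow_finrank (K := ZMod 2)
      (V := (pairKer N a k ω).comap (ofCoeffs (ZMod 2) k))
    rw [Nat.card_zmod, ← hcomap] at this
    exact this.symm
  have hcol : ∀ c : Fin k → ZMod 2, c ≠ 0 →
      (∑ ω : (Fin N → ZMod 2) × (Fin N → ZMod 2),
        if ofCoeffs (ZMod 2) k c ∈ pairKer N a k ω then 1 else 0) = 2 ^ (2 * (N - a)) := by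
    intro c hc
    set f := ofCoeffs (ZMod 2) k c with hf
    have hf0 : f ≠ 0 := (map_ne_zero_iff _ (ofCoeffs_injective k)).mpr hc
    have hfk := ofCoeffs_mem k c
    have hfdeg : natDegree f < k :=
      (natDegree_lt_iff_degree_lt hf0).mpr (mem_degreeLT.mp hfk)
    have hiff : ∀ ω : (Fin N → ZMod 2) × (Fin N → ZMod 2), f ∈ pairKer N a k ω ↔
        ω ∈ (annihilatedSeq N f a).prod (annihilatedSeq N f a) := by
      intro ω
      rw [Submodule.mem_prod, mem_annihilatedSeq, mem_annihilatedSeq, ← forall₂_and]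
      exact and_iff_right hfk
    simp only [hiff]
    have hrank := finrank_annihilatedSeq hf0 (show natDegree f + a ≤ N by omega)
    have hprod := natCard_eq_pow_finrank (K := ZMod 2) (V := annihilatedSeq N f a)
    rw [Finset.sum_boole, ← Fintype.card_subtype, ← Nat.card_eq_fintype_card]
    have hpair : Nat.card ((annihilatedSeq N f a).prod (annihilatedSeq N f a)) =
        2 ^ (2 * (N - a)) := by
      rw [Nat.card_congr (β := annihilatedSeq N f a × annihilatedSeq N f a)
        ⟨fun x => (⟨x.1.1, x.2.1⟩, ⟨x.1.2, x.2.2⟩), fun y => ⟨(y.1.1, y.2.1), y.1.2, y.2.2⟩,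
          fun _ => rfl, fun _ => rfl⟩, Nat.card_prod, hprod, Nat.card_zmod, ← pow_add]
      congr 1
      omega
    exact hpair
  simp only [hcard]
  rw [Finset.sum_comm, ← Finset.add_sum_erase _ _ (Finset.mem_univ (0 : Fin k → ZMod 2)),
    Finset.sum_congr rfl fun c hc => hcol c (Finset.ne_of_mem_erase hc)]
  simp [Finset.card_erase_of_mem, ZMod.card]
  ring

lemma sum_two_pow_sub_pairRank {N a k : ℕ} (h : a + k = N + 1) (hk : 0 < k) :
    (∑ ω : (Fin N → ZMod 2) × (Fin N → ZMod 2), 2 ^ (2 * a - pairRank N a k ω)) * 2 ^ k +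
      2 ^ (2 * N) = 2 ^ (2 * N + 2 * a) + 2 ^ (2 * N + k) := by
  have hterm : ∀ ω : (Fin N → ZMod 2) × (Fin N → ZMod 2),
      2 ^ (2 * a - pairRank N a k ω) * 2 ^ k =
        2 ^ finrank (ZMod 2) (pairKer N a k ω) * 2 ^ (2 * a) := by
    intro ω
    have h1 := finrank_pairKer (k := k) ω a
    have h2 := pairRank_le (k := k) ω a
    rw [← pow_add, ← pow_add]
    congr 1
    omega
  rw [Finset.sum_mul, Finset.sum_congr rfl fun ω _ => hterm ω, ← Finset.sum_mul,
    sum_two_pow_finrank_pairKer h, add_mul, mul_assoc, ← pow_add, ← pow_add,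
    show 2 * (N - a) + 2 * a = 2 * N by omega, add_assoc, pow_add 2 (2 * N) k]
  have : 1 ≤ 2 ^ k := Nat.one_le_two_pow
  zify [this]
  ring

/-- The number of elements of the left kernel, summed over the pairs of sequences for which
removing a row from each block and adding a column does not change the rank. -/
noncomputable def stableSum (N t k : ℕ) : ℕ :=
  ∑ ω : (Fin N → ZMod 2) × (Fin N → ZMod 2) with
    pairRank N (t + 1) k ω = pairRank N t (k + 1) ω, 2 ^ (2 * (t + 1) - pairRank N (t + 1) k ω)

lemma stableSum_add_natDegree {N t k : ℕ} {Q : (ZMod 2)[X]} (hk : 2 * t + 1 ≤ k)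
    (hN : N = t + k) (hQ : Q ≠ 0)
    (hQP : ∀ P : (ZMod 2)[X], P ≠ 0 → natDegree P ≤ 2 * t → IsCoprime Q P) :
    stableSum (N + natDegree Q) t (k + natDegree Q) = stableSum N t k := by
  have hrank : ∀ ω : (Fin (N + natDegree Q) → ZMod 2) × (Fin (N + natDegree Q) → ZMod 2),
      pairRank _ (t + 1) (k + natDegree Q) ω = pairRank _ t (k + natDegree Q + 1) ω →
      pairRank N (t + 1) k (ω.map (contract N _ Q) (contract N _ Q)) =
        pairRank _ (t + 1) (k + natDegree Q) ω ∧
      pairRank N (t + 1) k (ω.map (contract N _ Q) (contract N _ Q)) =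
        pairRank N t (k + 1) (ω.map (contract N _ Q) (contract N _ Q)) := by
    intro ω h
    obtain ⟨P, n, hP, -, -, h0, h1, h2⟩ := pairKer_contract_eq hk hN hQ hQP h
    have r0 := pairRank_of_eq_multiplesLT hP h0
    have r1 := pairRank_of_eq_multiplesLT hP h1
    have r2 := pairRank_of_eq_multiplesLT hP h2
    omega
  refine Finset.sum_bij (fun ω _ => ω.map (contract N _ Q) (contract N _ Q)) ?_ ?_ ?_ ?_
  · intro ω hω
    simp only [Finset.mem_filter, Finset.mem_univ, true_and] at hω ⊢
    exact (hrank ω hω).2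
  · intro ω hω ω' hω' heq
    simp only [Finset.mem_filter, Finset.mem_univ, true_and] at hω hω'
    exact contract_injOn hk hN hQ hQP hω hω' heq
  · intro ω hω
    simp only [Finset.mem_filter, Finset.mem_univ, true_and] at hω
    obtain ⟨ω', h, rfl⟩ := exists_pairRank_contract hk hN hQ hQP hω
    exact ⟨ω', by simpa using h, rfl⟩
  · intro ω hω
    simp only [Finset.mem_filter, Finset.mem_univ, true_and] at hω
    rw [(hrank ω hω).1]

lemma stableSum_eq {t k : ℕ} (hk : 2 * t + 1 ≤ k) :
    stableSum (t + k) t k = stableSum (t + (2 * t + 1)) t (2 * t + 1) := by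
  obtain ⟨m, hm⟩ := exists_isCoprime_of_natDegree_le (ZMod 2) (2 * t)
  obtain ⟨Q, hQ, hQm, hQP⟩ := hm m le_rfl
  obtain ⟨R, hR, hRm, hRP⟩ := hm (m + (k - (2 * t + 1))) (by omega)
  rw [← stableSum_add_natDegree hk rfl hQ hQP, ← stableSum_add_natDegree le_rfl rfl hR hRP,
    hQm, hRm]
  congr 1 <;> omega

lemma two_pow_pairRank_identity {N t k : ℕ} (hk : 2 * t + 1 ≤ k)
    (ω : (Fin N → ZMod 2) × (Fin N → ZMod 2)) :
    2 * 2 ^ (2 * (t + 1) - pairRank N (t + 1) k ω) + 2 =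
      4 * 2 ^ (2 * t - pairRank N t (k + 1) ω) +
      (2 * (if pairRank N (t + 1) k ω ≠ 2 * (t + 1) then 1 else 0) +
      if pairRank N (t + 1) k ω = pairRank N t (k + 1) ω then
        2 ^ (2 * (t + 1) - pairRank N (t + 1) k ω) else 0) := by
  have h0 := pairRank_le (k := k) ω (t + 1)
  have h1 := pairRank_le (k := k + 1) ω t
  have h2 := pairRank_succ_le_add_two (t := t) (k := k) ω
  have h3 := pairRank_succ_eq_of_eq_add_two (t := t) (k := k) ω
  have h4 := pairRank_le_pairRank_succ ω hk
  generalize pairRank N (t + 1) k ω = r at *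
  generalize pairRank N t (k + 1) ω = r' at *
  obtain rfl | rfl | rfl : r = r' ∨ r = r' + 1 ∨ r = r' + 2 := by omega
  · rw [if_pos (by omega), if_pos rfl, show 2 * (t + 1) - r = 2 * t - r + 2 by omega, pow_add]
    ring
  · rw [if_pos (by omega), if_neg (by omega),
      show 2 * (t + 1) - (r' + 1) = 2 * t - r' + 1 by omega, pow_add]
    ring
  · have := h3 rfl
    rw [if_neg (by omega), if_neg (by omega), show 2 * (t + 1) - (r' + 2) = 0 by omega,
      show 2 * t - r' = 0 by omega]
    norm_num

lemma two_mul_card_add_stableSum {N t k : ℕ} (hk : 2 * t + 1 ≤ k) (hN : N = t + k) :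
    2 * (Finset.univ.filter fun ω : (Fin N → ZMod 2) × (Fin N → ZMod 2) =>
      pairRank N (t + 1) k ω ≠ 2 * (t + 1)).card + stableSum N t k = 6 * 2 ^ (4 * t + k) := by
  have hsum := Finset.sum_congr (rfl : Finset.univ = Finset.univ)
    fun (ω : (Fin N → ZMod 2) × (Fin N → ZMod 2)) _ => two_pow_pairRank_identity hk ω
  simp only [Finset.sum_add_distrib, ← Finset.mul_sum, Finset.sum_boole, ← Finset.sum_filter,
    Finset.sum_const, Finset.card_univ, Fintype.card_prod, Fintype.card_fun, ZMod.card,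
    Fintype.card_fin, smul_eq_mul, Nat.cast_id] at hsum
  have m0 := sum_two_pow_sub_pairRank (N := N) (a := t + 1) (k := k) (by omega) (by omega)
  have m1 := sum_two_pow_sub_pairRank (N := N) (a := t) (k := k + 1) (by omega) (by omega)
  rw [← stableSum] at hsum
  refine Nat.eq_of_mul_eq_mul_right (Nat.two_pow_pos k) ?_
  subst hN
  zify at *
  ring_nf at *
  linear_combination (-2 ^ k) * hsum + 2 * m0 - 2 * m1

lemma hankel_fromRows_rank {s k : ℕ}
    (p : (Fin (s + k - 1) → ZMod 2) × (Fin (s + k - 1) → ZMod 2)) :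
    (Matrix.fromRows (hankel s k p.1) (hankel s k p.2)).rank = pairRank (s + k - 1) s k p := by
  have hentry : ∀ (α : Fin (s + k - 1) → ZMod 2) (i : Fin s) (j : Fin k),
      hankel s k α i j = momentFunctional (ZMod 2) _ α (X ^ ((i : ℕ) + (j : ℕ))) := fun α i j =>
    (momentFunctional_X_pow α ⟨(i : ℕ) + (j : ℕ), by omega⟩).symm
  rw [pairRank, stackedHankel]
  congr 2 <;> ext i j <;> exact hentry _ i j

lemma Gamma_eq_card (s k i : ℕ) : Gamma s s k i =
    (Finset.univ.filter fun ω : (Fin (s + k - 1) → ZMod 2) × (Fin (s + k - 1) → ZMod 2) =>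
      pairRank (s + k - 1) s k ω = i).card := by
  classical
  rw [Gamma, ← Fintype.card_subtype, ← Nat.card_eq_fintype_card]
  simp only [hankel_fromRows_rank]

end GammaCount

theorem Gamma_full_rank_square_case (s k : ℕ) (hs : 2 ≤ s) (hk : 2 * s < k) :
    (Gamma s s k (2 * s) : ℤ) = 2 ^ (2 * k + 2 * s - 2) - 3 * 2 ^ (k + 4 * s - 4) + 2 ^ (6 * s - 5) := by
  obtain ⟨t, rfl⟩ : ∃ t, s = t + 1 := ⟨s - 1, by omega⟩
  have hgen := two_mul_card_add_stableSum (t := t) (k := k) (by omega) rfl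
  have hbase := two_mul_card_add_stableSum (t := t) (k := 2 * t + 1) le_rfl rfl
  rw [stableSum_eq (by omega)] at hgen
  have hall : (Finset.univ.filter fun ω : (Fin (t + (2 * t + 1)) → ZMod 2) ×
      (Fin (t + (2 * t + 1)) → ZMod 2) =>
      pairRank _ (t + 1) (2 * t + 1) ω ≠ 2 * (t + 1)) = Finset.univ := by
    refine Finset.filter_true_of_mem fun ω _ => ?_
    have := finrank_pairKer (k := 2 * t + 1) ω (t + 1)
    omega
  rw [hall, Finset.card_univ] at hbase
  rw [Gamma_eq_card, show t + 1 + k - 1 = t + k by omega]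
  have hcompl := Finset.card_filter_add_card_filter_not
    (s := (Finset.univ : Finset ((Fin (t + k) → ZMod 2) × (Fin (t + k) → ZMod 2))))
    (fun ω => pairRank (t + k) (t + 1) k ω = 2 * (t + 1))
  rw [Finset.card_univ] at hcompl
  simp only [Fintype.card_prod, Fintype.card_fun, ZMod.card, Fintype.card_fin] at hbase hcompl
  rw [show 2 * k + 2 * (t + 1) - 2 = 2 * k + 2 * t by omega,
    show k + 4 * (t + 1) - 4 = k + 4 * t by omega, show 6 * (t + 1) - 5 = 6 * t + 1 by omega]
  simp only [ne_eq] at hgen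
  zify at *
  ring_nf at *
  linarith
end
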